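/- arXiv:1110.2706 — 2 statements merged into one kernel-verified Lean document; each statement's English description precedes it below -/
import Mathlib

section
/- Let n ≥ p. Then every minimal second syzygy of W_{n,p} has constant Jordan type ⊕_{i=1}^{p−1} [i] ⊕ (n+1)[p]. -/
open MvPolynomial Module

set_option maxHeartbeats 1000000
set_option synthInstance.maxHeartbeats 400000

noncomputable section

/-- The defining ideal `(X^p, Y^p)` of the polynomial ring in two variables. -/
def relI (k : Type) [Field k] (p : ℕ) : Ideal (MvPolynomial (Fin 2) k) :=
  Ideal.span {(X 0 : MvPolynomial (Fin 2) k) ^ p, (X 1 : MvPolynomial (Fin 2) k) ^ p}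

/-- The algebra `A = k[X,Y]/(X^p, Y^p)`. -/
abbrev Amod (k : Type) [Field k] (p : ℕ) : Type :=
  MvPolynomial (Fin 2) k ⧸ relI k p

variable (k : Type) [Field k] (p : ℕ)

/-- `x`, the image of `X` in `A`. -/
def xA : Amod k p := Ideal.Quotient.mk (relI k p) (X 0)

/-- `y`, the image of `Y` in `A`. -/
def yA : Amod k p := Ideal.Quotient.mk (relI k p) (X 1)

/-- The maximal ideal `𝔪 = (x, y)` of `A`. -/
def mA : Ideal (Amod k p) := Ideal.span {xA k p, yA k p}

/-- A point operator: `u = α x + β y` with `(α, β) ≠ (0, 0)`. -/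
def IsPointOp (u : Amod k p) : Prop :=
  ∃ α β : k, (α ≠ 0 ∨ β ≠ 0) ∧ u = α • xA k p + β • yA k p

/-- Equal images property: `u M = 𝔪 M` for every point operator `u`. -/
def EIP (M : Type) [AddCommGroup M] [Module (Amod k p) M] : Prop :=
  ∀ u : Amod k p, IsPointOp k p u →
    LinearMap.range (LinearMap.lsmul (Amod k p) M u)
      = mA k p • (⊤ : Submodule (Amod k p) M)

/-- `M` lies in `EIP_d`: equal images property and `𝔪^d M = 0`. -/
def EIPd (d : ℕ) (M : Type) [AddCommGroup M] [Module (Amod k p) M] : Prop :=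
  EIP k p M ∧ (mA k p) ^ d • (⊤ : Submodule (Amod k p) M) = ⊥


/-- The standard basis vector `v_i` of the free module `A^n`. -/
def stdV (n : ℕ) (i : Fin n) : Fin n → Amod k p := Pi.single i 1

/-- The set of defining relations of the module `W_{n,d}` inside the free module `A^n`
(indices of `v_1, …, v_n` are `0, …, n-1`): `x·v_1`, `y·v_n`, `x^d·v_i` for `2 ≤ i ≤ n`,
and `y·v_i − x·v_{i+1}` for `1 ≤ i ≤ n−1`. -/
def NSet (n d : ℕ) : Set (Fin n → Amod k p) :=
  (⋃ (i : Fin n) (_ : i.val = 0), {xA k p • stdV k p n i}) ∪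
  (⋃ (i : Fin n) (_ : i.val = n - 1), {yA k p • stdV k p n i}) ∪
  (⋃ (i : Fin n) (_ : i.val ≠ 0), {(xA k p) ^ d • stdV k p n i}) ∪
  (⋃ (i : Fin n) (j : Fin n) (_ : j.val = i.val + 1),
    {yA k p • stdV k p n i - xA k p • stdV k p n j})

/-- The submodule `N_{n,d} ⊆ A^n` of defining relations of `W_{n,d}`. -/
def NSub (n d : ℕ) : Submodule (Amod k p) (Fin n → Amod k p) :=
  Submodule.span (Amod k p) (NSet k p n d)

/-- The module `W_{n,d} = A^n / N_{n,d}`. -/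
abbrev Wmod (n d : ℕ) : Type := (Fin n → Amod k p) ⧸ NSub k p n d

/-- `M` has constant Jordan type `⊕ a_i [i]`: for every point operator `u`, the nilpotent
operator `u_M` has exactly `a i` Jordan blocks of size `i` (`1 ≤ i ≤ p`), expressed through
ranks: `rank(u_M^j) = Σ_{i=j+1}^p (i−j)·a i` for `1 ≤ j ≤ p−1` and
`dim_k M = Σ_{i=1}^p i·a i`. -/
def ConstantJordanType (a : ℕ → ℕ) (M : Type) [AddCommGroup M] [Module (Amod k p) M]
    [Module k M] [IsScalarTower k (Amod k p) M] : Prop :=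
  finrank k M = ∑ i ∈ Finset.Icc 1 p, i * a i ∧
  ∀ u : Amod k p, IsPointOp k p u → ∀ j : ℕ, 1 ≤ j → j ≤ p - 1 →
    finrank k (↥(LinearMap.range ((LinearMap.lsmul (Amod k p) M u) ^ j)))
      = ∑ i ∈ Finset.Icc (j + 1) p, (i - j) * a i

/-- `M` is an indecomposable `A`-module: it is nonzero and admits no nontrivial internal
direct sum decomposition. -/
def IsIndecomposableMod (M : Type) [AddCommGroup M] [Module (Amod k p) M] : Prop :=
  Nontrivial M ∧ ∀ N N' : Submodule (Amod k p) M, IsCompl N N' → N = ⊥ ∨ N' = ⊥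

/-- `IsMinSyz m N M`: the `A`-module `N` is a minimal `m`-th syzygy of `M`, i.e. it arises
(up to isomorphism) as the last kernel `ker(F_{m−1} → F_{m−2})` of an exact sequence
`F_{m−1} → ⋯ → F_1 → F_0 → M → 0` of finitely generated free `A`-modules `F_i` with
`ker(F_0 → M) ⊆ 𝔪F_0` and `ker(F_i → F_{i−1}) ⊆ 𝔪F_i`; equivalently, it is obtained by
`m`-fold iteration of minimal first syzygies. -/
def IsMinSyz : ℕ → ModuleCat.{0} (Amod k p) → ModuleCat.{0} (Amod k p) → Prop
  | 0, N, M => Nonempty ((↥N) ≃ₗ[Amod k p] (↥M))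
  | (m + 1), N, M => ∃ (r : ℕ) (g : (Fin r → Amod k p) →ₗ[Amod k p] M),
      Function.Surjective g ∧
      LinearMap.ker g ≤ mA k p • (⊤ : Submodule (Amod k p) (Fin r → Amod k p)) ∧
      IsMinSyz m N (ModuleCat.of (Amod k p) (↥(LinearMap.ker g)))


/-! ### General linear algebra -/

theorem rank_formula_aux {K A F M : Type} [Field K] [CommRing A] [Algebra K A]
    [AddCommGroup F] [Module A F] [Module K F] [IsScalarTower K A F] [FiniteDimensional K F]
    [AddCommGroup M] [Module A M] [Module K M] [IsScalarTower K A M]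
    (g : F →ₗ[A] M) (hg : Function.Surjective g) (a b : A)
    (hab : LinearMap.ker (LinearMap.lsmul A F a) = LinearMap.range (LinearMap.lsmul A F b)) :
    finrank K (LinearMap.range (LinearMap.lsmul A (LinearMap.ker g) a))
      + finrank K (LinearMap.range (LinearMap.lsmul A F b))
    = finrank K (LinearMap.ker g) + finrank K (LinearMap.range (LinearMap.lsmul A M b)) := by
  have : FiniteDimensional K (LinearMap.ker g) :=
    inferInstanceAs (FiniteDimensional K ((LinearMap.ker g).restrictScalars K))
  have : FiniteDimensional K (LinearMap.range (LinearMap.lsmul A F b)) :=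
    inferInstanceAs (FiniteDimensional K ((LinearMap.range (LinearMap.lsmul A F b)).restrictScalars K))
  have h1 := LinearMap.finrank_range_add_finrank_ker
    ((LinearMap.lsmul A (LinearMap.ker g) a).restrictScalars K)
  have h2 := LinearMap.finrank_range_add_finrank_ker
    ((g.domRestrict (LinearMap.range (LinearMap.lsmul A F b))).restrictScalars K)
  have h3 : finrank K (LinearMap.range
      ((g.domRestrict (LinearMap.range (LinearMap.lsmul A F b))).restrictScalars K))
      = finrank K (LinearMap.range (LinearMap.lsmul A M b)) := by
    have : LinearMap.range
      ((g.domRestrict (LinearMap.range (LinearMap.lsmul A F b))).restrictScalars K)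
      = (LinearMap.range (LinearMap.lsmul A M b)).restrictScalars K := by
      ext z
      constructor
      · rintro ⟨⟨_, f, rfl⟩, rfl⟩
        exact ⟨g f, by simp⟩
      · rintro ⟨m, rfl⟩
        obtain ⟨f, rfl⟩ := hg m
        exact ⟨⟨_, f, rfl⟩, by simp⟩
    rw [this]
    rfl
  have h4 : finrank K (LinearMap.ker
      ((g.domRestrict (LinearMap.range (LinearMap.lsmul A F b))).restrictScalars K))
      = finrank K (LinearMap.ker ((LinearMap.lsmul A (LinearMap.ker g) a).restrictScalars K)) := by
    refine LinearEquiv.finrank_eq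
      { toFun := fun z => ⟨⟨z.1.1, z.2⟩, ?_⟩
        invFun := fun z => ⟨⟨z.1.1, ?_⟩, z.1.2⟩
        left_inv := fun z => rfl
        right_inv := fun z => rfl
        map_add' := fun z w => rfl
        map_smul' := fun z w => rfl }
    · have : z.1.1 ∈ LinearMap.ker (LinearMap.lsmul A F a) := by rw [hab]; exact z.1.2
      apply Subtype.ext
      simpa using this
    · rw [← hab]
      have : (LinearMap.lsmul A (LinearMap.ker g) a) z.1 = 0 := z.2
      have := congrArg Subtype.val this
      simpa using this
  have h5 : finrank K (LinearMap.range (LinearMap.lsmul A (LinearMap.ker g) a))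
    = finrank K (LinearMap.range ((LinearMap.lsmul A (LinearMap.ker g) a).restrictScalars K)) := rfl
  rw [h3, h4] at h2
  rw [h5]
  have h6 : finrank K (LinearMap.range (LinearMap.lsmul A F b))
    = finrank K (↥(LinearMap.range (LinearMap.lsmul A F b))) := rfl
  omega

theorem cover_surj {A M : Type} [CommRing A] [AddCommGroup M] [Module A M]
    (I : Ideal A) (hI : I ≤ Ideal.jacobson ⊥) {r s : ℕ}
    (g : (Fin r → A) →ₗ[A] M) (q : (Fin s → A) →ₗ[A] M)
    (hg : Function.Surjective g) 
    (hq' : LinearMap.ker q ≤ I • (⊤ : Submodule A (Fin s → A)))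
    (φ : (Fin r → A) →ₗ[A] (Fin s → A)) (h : q ∘ₗ φ = g) : Function.Surjective φ := by
  rw [← LinearMap.range_eq_top, eq_top_iff]
  refine Submodule.le_of_le_smul_of_le_jacobson_bot (I := I) Module.Finite.fg_top hI ?_
  intro v _
  obtain ⟨w, hw⟩ := hg (q v)
  have : v - φ w ∈ LinearMap.ker q := by
    simp [← hw, ← h]
  have := hq' this
  have h2 : v = φ w + (v - φ w) := by abel
  rw [h2]
  exact Submodule.add_mem_sup ⟨w, rfl⟩ this

theorem cover_unique {A M : Type} [CommRing A] [Nontrivial A] [AddCommGroup M] [Module A M]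
    (I : Ideal A) (hI : I ≤ Ideal.jacobson ⊥) {r s : ℕ}
    (g : (Fin r → A) →ₗ[A] M) (q : (Fin s → A) →ₗ[A] M)
    (hg : Function.Surjective g) (hq : Function.Surjective q)
    (hg' : LinearMap.ker g ≤ I • (⊤ : Submodule A (Fin r → A)))
    (hq' : LinearMap.ker q ≤ I • (⊤ : Submodule A (Fin s → A))) :
    r = s ∧ Nonempty (LinearMap.ker g ≃ₗ[A] LinearMap.ker q) := by
  obtain ⟨φ, hφ⟩ := Module.projective_lifting_property q g hq
  obtain ⟨ψ, hψ⟩ := Module.projective_lifting_property g q hg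
  have sφ := cover_surj I hI g q hg hq' φ hφ
  have sψ := cover_surj I hI q g hq hg' ψ hψ
  have hrs : r = s := le_antisymm (le_of_fin_surjective A ψ sψ) (le_of_fin_surjective A φ sφ)
  refine ⟨hrs, ?_⟩
  subst hrs
  have iφ : Function.Injective φ := OrzechProperty.injective_of_surjective_endomorphism φ sφ
  let e := LinearEquiv.ofBijective φ ⟨iφ, sφ⟩
  refine ⟨e.ofSubmodules _ _ ?_⟩
  ext z
  constructor
  · rintro ⟨w, hw, rfl⟩
    have : q (φ w) = g w := by rw [← hφ]; rfl
    change q (φ w) = 0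
    rw [this]; exact hw
  · intro hz
    obtain ⟨w, rfl⟩ := sφ z
    have : q (φ w) = g w := by rw [← hφ]; rfl
    refine ⟨w, ?_, rfl⟩
    change g w = 0
    rw [← this]; exact hz

/-! ### The algebra `A` -/

theorem A_induct (P : Amod k p → Prop) (hC : ∀ c : k, P (algebraMap k _ c))
    (hadd : ∀ a b, P a → P b → P (a + b)) (hx : ∀ a, P a → P (a * xA k p))
    (hy : ∀ a, P a → P (a * yA k p)) (a : Amod k p) : P a := by
  obtain ⟨f, rfl⟩ := Ideal.Quotient.mk_surjective a
  induction f using MvPolynomial.induction_on with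
  | C c => exact hC c
  | add f g hf hg => rw [map_add]; exact hadd _ _ hf hg
  | mul_X f i hf =>
    rw [map_mul]
    fin_cases i
    · exact hx _ hf
    · exact hy _ hf

theorem xA_pow : xA k p ^ p = 0 := by
  rw [xA, ← map_pow]
  exact Ideal.Quotient.eq_zero_iff_mem.2 (Ideal.subset_span (by simp))

theorem yA_pow : yA k p ^ p = 0 := by
  rw [yA, ← map_pow]
  exact Ideal.Quotient.eq_zero_iff_mem.2 (Ideal.subset_span (by simp))

theorem exists_lift (B : Type) [CommRing B] [Algebra k B] (a b : B) (ha : a ^ p = 0)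
    (hb : b ^ p = 0) : ∃ ρ : Amod k p →ₐ[k] B, ρ (xA k p) = a ∧ ρ (yA k p) = b := by
  refine ⟨Ideal.Quotient.liftₐ (relI k p) (aeval ![a, b]) ?_, ?_, ?_⟩
  · intro z hz
    have : relI k p ≤ RingHom.ker (aeval ![a, b] : MvPolynomial (Fin 2) k →ₐ[k] B) := by
      rw [relI, Ideal.span_le]
      intro z hz
      simp only [Set.mem_insert_iff, Set.mem_singleton_iff] at hz
      rcases hz with rfl | rfl
      · simp [RingHom.mem_ker, ha]
      · simp [RingHom.mem_ker, hb]
    exact this hz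
  · change aeval ![a, b] (X 0 : MvPolynomial (Fin 2) k) = a
    exact aeval_X _ _
  · change aeval ![a, b] (X 1 : MvPolynomial (Fin 2) k) = b
    exact aeval_X _ _

theorem exists_rep (V : Type) [AddCommGroup V] [Module k V] (X Y : Module.End k V)
    (hXY : X * Y = Y * X) (hX : X ^ p = 0) (hY : Y ^ p = 0) :
    ∃ ρ : Amod k p →ₐ[k] Module.End k V, ρ (xA k p) = X ∧ ρ (yA k p) = Y := by
  let _ : CommRing (Algebra.adjoin k {X, Y}) := Algebra.adjoinCommRingOfComm k (by
    intro a ha b hb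
    simp only [Set.mem_insert_iff, Set.mem_singleton_iff] at ha hb
    rcases ha with rfl | rfl <;> rcases hb with rfl | rfl
    · rfl
    · exact hXY
    · exact hXY.symm
    · rfl)
  let X' : Algebra.adjoin k {X, Y} := ⟨X, Algebra.subset_adjoin (by simp)⟩
  let Y' : Algebra.adjoin k {X, Y} := ⟨Y, Algebra.subset_adjoin (by simp)⟩
  obtain ⟨ρ, h1, h2⟩ := exists_lift k p (Algebra.adjoin k {X, Y}) X' Y'
    (Subtype.ext hX) (Subtype.ext hY)
  exact ⟨(Algebra.adjoin k {X, Y}).val.comp ρ, by simp [h1, X'], by simp [h2, Y']⟩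

theorem mA_le_jac : mA k p ≤ Ideal.jacobson ⊥ := by
  rw [mA, Ideal.span_le]
  rw [Ideal.jacobson_bot]
  intro z hz
  simp only [Set.mem_insert_iff, Set.mem_singleton_iff] at hz
  rcases hz with rfl | rfl
  · exact nilradical_le_jacobson _ (mem_nilradical.2 ⟨p, xA_pow k p⟩)
  · exact nilradical_le_jacobson _ (mem_nilradical.2 ⟨p, yA_pow k p⟩)

theorem exists_aug (a : Amod k p) : ∃ c : k, a - algebraMap k _ c ∈ mA k p := by
  refine A_induct k p (fun a => ∃ c : k, a - algebraMap k _ c ∈ mA k p) ?_ ?_ ?_ ?_ a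
  · intro c; exact ⟨c, by simp⟩
  · rintro a b ⟨c, hc⟩ ⟨d, hd⟩
    refine ⟨c + d, ?_⟩
    have := add_mem hc hd
    rw [map_add]
    convert this using 1
    ring
  · intro a _
    refine ⟨0, ?_⟩
    rw [map_zero, sub_zero]
    exact Ideal.mul_mem_left _ _ (Ideal.subset_span (by simp))
  · intro a _
    refine ⟨0, ?_⟩
    rw [map_zero, sub_zero]
    exact Ideal.mul_mem_left _ _ (Ideal.subset_span (by simp))

theorem mem_of_aug (s t : k) (z b : Amod k p)
    (ρ : Amod k p →ₐ[k] DualNumber k)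
    (hx : ρ (xA k p) = algebraMap k _ s * DualNumber.eps)
    (hy : ρ (yA k p) = algebraMap k _ t * DualNumber.eps)
    (hz : ρ z = DualNumber.eps)
    (h : ρ (z * b) = 0) : b ∈ mA k p := by
  obtain ⟨d, hd⟩ := exists_aug k p b
  have hm : ∀ z ∈ mA k p, DualNumber.eps * ρ z = 0 := by
    intro z hz
    refine Submodule.span_induction ?_ ?_ ?_ ?_ hz
    · intro z hz
      simp only [Set.mem_insert_iff, Set.mem_singleton_iff] at hz
      rcases hz with rfl | rfl
      · rw [hx, mul_left_comm, DualNumber.eps_mul_eps, mul_zero]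
      · rw [hy, mul_left_comm, DualNumber.eps_mul_eps, mul_zero]
    · simp
    · intro a b _ _ ha hb
      rw [map_add, mul_add, ha, hb, add_zero]
    · intro a b _ hb
      rw [smul_eq_mul, map_mul, mul_left_comm, hb, mul_zero]
  have h1 := hm _ hd
  rw [map_sub, mul_sub, AlgHom.commutes] at h1
  rw [map_mul, hz, sub_eq_zero.1 h1] at h
  have h2 := congrArg TrivSqZeroExt.snd h
  have : d = 0 := by
    simpa [TrivSqZeroExt.algebraMap_eq_inl] using h2
  rw [this] at hd
  simpa using hd

theorem rel_mem (hp : 2 ≤ p) (b c : Amod k p) (h : yA k p * b = xA k p * c) :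
    b ∈ mA k p ∧ c ∈ mA k p := by
  have he : (DualNumber.eps : DualNumber k) ^ p = 0 := by
    obtain ⟨q, rfl⟩ := Nat.exists_eq_add_of_le hp
    rw [pow_add, pow_two, DualNumber.eps_mul_eps, zero_mul]
  have h0 : (0 : DualNumber k) ^ p = 0 := zero_pow (by omega)
  constructor
  · obtain ⟨ρ, hx, hy⟩ := exists_lift k p (DualNumber k) 0 DualNumber.eps h0 he
    refine mem_of_aug k p 0 1 (yA k p) b ρ (by simp [hx]) (by simp [hy]) hy ?_
    rw [h, map_mul, hx, zero_mul]
  · obtain ⟨ρ, hx, hy⟩ := exists_lift k p (DualNumber k) DualNumber.eps 0 he h0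
    refine mem_of_aug k p 1 0 (xA k p) c ρ (by simp [hx]) (by simp [hy]) hx ?_
    rw [← h, map_mul, hy, zero_mul]

/-! ### Ranks from a shifted family -/

theorem shift_family {K M : Type} [Field K] [AddCommGroup M] [Module K M]
    (T : Module.End K M) (b : ℕ × ℕ → M) (S : Finset (ℕ × ℕ))
    (Φ : M →ₗ[K] (ℕ × ℕ → K)) (hΦ : ∀ s ∈ S, Φ (b s) = Pi.single s 1)
    (hS : ∀ s, s ∉ S → b s = 0) (hspan : Submodule.span K (Set.range b) = ⊤)
    (hT : ∀ j i, T (b (j, i)) = b (j + 1, i)) :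
    FiniteDimensional K M ∧
    ∀ m, finrank K (LinearMap.range (T ^ m)) = (S.filter (fun s => m ≤ s.1)).card := by
  classical
  have hTm : ∀ m j i, (T ^ m) (b (j, i)) = b (j + m, i) := by
    intro m
    induction m with
    | zero => intro j i; simp
    | succ m ih =>
      intro j i
      rw [pow_succ', Module.End.mul_apply, ih, hT]
      rfl
  have hr : ∀ m, LinearMap.range (T ^ m)
      = Submodule.span K (Set.range fun s : S.filter (fun s => m ≤ s.1) => b s.1) := by
    intro m
    rw [← Submodule.map_top, ← hspan, Submodule.map_span]
    apply le_antisymm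
    · rw [Submodule.span_le]
      rintro _ ⟨_, ⟨⟨j, i⟩, rfl⟩, rfl⟩
      rw [hTm]
      by_cases h : (j + m, i) ∈ S
      · exact Submodule.subset_span ⟨⟨(j + m, i), by simp [h]⟩, rfl⟩
      · rw [hS _ h]; exact zero_mem _
    · rw [Submodule.span_le]
      rintro _ ⟨⟨⟨j, i⟩, hs⟩, rfl⟩
      rw [Finset.mem_filter] at hs
      refine Submodule.subset_span ⟨b (j - m, i), ⟨_, rfl⟩, ?_⟩
      rw [hTm, Nat.sub_add_cancel hs.2]
  have hli : ∀ m, LinearIndependent K (fun s : S.filter (fun s => m ≤ s.1) => b s.1) := by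
    intro m
    refine LinearIndependent.of_comp Φ ?_
    rw [Fintype.linearIndependent_iff]
    intro g hg t
    have := congrFun hg t.1
    rw [Finset.sum_apply, Finset.sum_eq_single t] at this
    · rw [Pi.smul_apply, Function.comp_apply, hΦ _ (Finset.mem_filter.1 t.2).1] at this
      simpa using this
    · intro s _ hst
      rw [Pi.smul_apply, Function.comp_apply, hΦ _ (Finset.mem_filter.1 s.2).1]
      have : t.1 ≠ s.1 := fun h => hst (Subtype.ext h.symm)
      simp [this]
    · simp
  refine ⟨?_, ?_⟩
  · have := hr 0
    rw [pow_zero, Module.End.one_eq_id, LinearMap.range_id] at this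
    exact ⟨Submodule.fg_def.2 ⟨_, Set.finite_range _, this.symm⟩⟩
  · intro m
    rw [hr m, finrank_span_eq_card (hli m)]
    simp

/-- A truncated shift on functions. -/
def Sh (P : ℕ × ℕ → Prop) [DecidablePred P] (τ : ℕ × ℕ → ℕ × ℕ) : Module.End k (ℕ × ℕ → k) where
  toFun g s := if P s then g (τ s) else 0
  map_add' g h := by ext s; by_cases hs : P s <;> simp [hs]
  map_smul' c g := by ext s; by_cases hs : P s <;> simp [hs]

theorem Sh_apply (P : ℕ × ℕ → Prop) [DecidablePred P] (τ : ℕ × ℕ → ℕ × ℕ) (g : ℕ × ℕ → k)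
    (s : ℕ × ℕ) : Sh k P τ g s = if P s then g (τ s) else 0 := rfl

theorem Sh_single (P : ℕ × ℕ → Prop) [DecidablePred P] (τ : ℕ × ℕ → ℕ × ℕ) (t t' : ℕ × ℕ)
    (h : ∀ s, (P s ∧ τ s = t) ↔ s = t') :
    Sh k P τ (Pi.single t 1) = Pi.single t' 1 := by
  ext s
  have := h s
  rw [Sh_apply, Pi.single_apply, Pi.single_apply]
  by_cases h1 : P s <;> by_cases h2 : τ s = t <;> simp_all

theorem Sh_single_zero (P : ℕ × ℕ → Prop) [DecidablePred P] (τ : ℕ × ℕ → ℕ × ℕ) (t : ℕ × ℕ)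
    (h : ∀ s, P s → τ s ≠ t) :
    Sh k P τ (Pi.single t 1) = 0 := by
  ext s
  have := h s
  rw [Sh_apply, Pi.single_apply]
  by_cases h1 : P s <;> simp_all

theorem Sh_pow (hp : 1 ≤ p) (P : ℕ × ℕ → Prop) [DecidablePred P] (τ : ℕ × ℕ → ℕ × ℕ)
    (ht : ℕ × ℕ → ℕ) (h : ∀ s, P s → ht (τ s) < ht s ∧ ht s < p) : Sh k P τ ^ p = 0 := by
  have key : ∀ m g s, ht s < m → (Sh k P τ ^ m) g s = 0 := by
    intro m
    induction m with
    | zero => intro g s hs; omega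
    | succ m ih =>
      intro g s hs
      rw [pow_succ', Module.End.mul_apply, Sh_apply]
      split_ifs with h1
      · apply ih
        have := h s h1
        omega
      · rfl
  ext g s
  by_cases h1 : P s
  · exact key p _ s (h s h1).2
  · obtain ⟨q, rfl⟩ := Nat.exists_eq_add_of_le' hp
    simp only [pow_succ', Module.End.mul_apply, LinearMap.comp_apply]
    rw [Sh_apply, if_neg h1]
    rfl

theorem lsmul_pow_eq {A M : Type} [CommRing A] [AddCommGroup M] [Module A M] (a : A) (m : ℕ) :
    LinearMap.lsmul A M a ^ m = LinearMap.lsmul A M (a ^ m) := by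
  ext z
  induction m generalizing z with
  | zero => simp
  | succ m ih =>
    rw [pow_succ, Module.End.mul_apply, ih]
    simp [pow_succ, mul_smul, smul_comm a]

theorem restrict_pow {A M : Type} [CommRing A] [Algebra k A] [AddCommGroup M] [Module A M]
    [Module k M] [IsScalarTower k A M] (a : A) (m : ℕ) :
    ((LinearMap.lsmul A M a).restrictScalars k) ^ m
      = (LinearMap.lsmul A M (a ^ m)).restrictScalars k := by
  ext z
  induction m generalizing z with
  | zero => simp
  | succ m ih =>
    rw [pow_succ, Module.End.mul_apply, ih]
    simp [pow_succ, mul_smul, smul_comm a]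

/-! ### ranks on `A` -/

theorem A_rank_x (hp : 1 ≤ p) : FiniteDimensional k (Amod k p) ∧
    ∀ m, finrank k (LinearMap.range (LinearMap.lsmul (Amod k p) (Amod k p) (xA k p ^ m)))
      = (p - m) * p := by
  classical
  obtain ⟨ρ, hx, hy⟩ := exists_rep k p (ℕ × ℕ → k)
    (Sh k (fun s => 1 ≤ s.1 ∧ s.1 < p) (fun s => (s.1 - 1, s.2)))
    (Sh k (fun s => 1 ≤ s.2 ∧ s.2 < p) (fun s => (s.1, s.2 - 1)))
    (by
      ext g s
      simp only [LinearMap.comp_apply, Module.End.mul_apply, Sh_apply]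
      split_ifs <;> rfl)
    (Sh_pow k p hp _ _ (fun s => s.1) (by intro s hs; dsimp only; omega))
    (Sh_pow k p hp _ _ (fun s => s.2) (by intro s hs; dsimp only; omega))
  have h1 : ∀ i, i < p → (ρ (yA k p ^ i)) (Pi.single (0, 0) 1) = Pi.single (0, i) 1 := by
    intro i
    induction i with
    | zero => intro _; simp
    | succ i ih =>
      intro hi
      rw [pow_succ', map_mul, Module.End.mul_apply, ih (by omega), hy]
      apply Sh_single
      rintro ⟨a, b⟩
      simp only [Prod.mk.injEq]
      omega
  have h2 : ∀ j i, j < p → i < p →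
      (ρ (xA k p ^ j * yA k p ^ i)) (Pi.single (0, 0) 1) = Pi.single (j, i) 1 := by
    intro j i
    induction j with
    | zero => intro _ hi; simpa using h1 i hi
    | succ j ih =>
      intro hj hi
      rw [pow_succ', mul_assoc, map_mul, Module.End.mul_apply, ih (by omega) hi, hx]
      apply Sh_single
      rintro ⟨a, b⟩
      simp only [Prod.mk.injEq]
      omega
  have hspan : Submodule.span k (Set.range fun s : ℕ × ℕ => xA k p ^ s.1 * yA k p ^ s.2) = ⊤ := by
    rw [eq_top_iff]
    rintro a -
    refine A_induct k p (fun a => a ∈ Submodule.span k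
      (Set.range fun s : ℕ × ℕ => xA k p ^ s.1 * yA k p ^ s.2)) ?_ ?_ ?_ ?_ a
    · intro c
      rw [Algebra.algebraMap_eq_smul_one]
      exact Submodule.smul_mem _ _ (Submodule.subset_span ⟨(0, 0), by simp⟩)
    · intro a b ha hb; exact add_mem ha hb
    · intro a ha
      refine Submodule.span_induction ?_ ?_ ?_ ?_ ha
      · rintro _ ⟨⟨j, i⟩, rfl⟩
        exact Submodule.subset_span ⟨(j + 1, i), by simp only; ring⟩
      · rw [zero_mul]; exact zero_mem _
      · intro a b _ _ ha hb; rw [add_mul]; exact add_mem ha hb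
      · intro c a _ ha; rw [smul_mul_assoc]; exact Submodule.smul_mem _ _ ha
    · intro a ha
      refine Submodule.span_induction ?_ ?_ ?_ ?_ ha
      · rintro _ ⟨⟨j, i⟩, rfl⟩
        exact Submodule.subset_span ⟨(j, i + 1), by simp only; ring⟩
      · rw [zero_mul]; exact zero_mem _
      · intro a b _ _ ha hb; rw [add_mul]; exact add_mem ha hb
      · intro c a _ ha; rw [smul_mul_assoc]; exact Submodule.smul_mem _ _ ha
  obtain ⟨hfd, hrk⟩ := shift_family
    ((LinearMap.lsmul (Amod k p) (Amod k p) (xA k p)).restrictScalars k)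
    (fun s : ℕ × ℕ => xA k p ^ s.1 * yA k p ^ s.2) (Finset.range p ×ˢ Finset.range p)
    ((LinearMap.applyₗ (Pi.single (0, 0) 1 : ℕ × ℕ → k)).comp ρ.toLinearMap)
    (by
      rintro ⟨j, i⟩ hs
      simp only [Finset.mem_product, Finset.mem_range] at hs
      exact h2 j i hs.1 hs.2)
    (by
      rintro ⟨j, i⟩ hs
      simp only [Finset.mem_product, Finset.mem_range, not_and_or, not_lt] at hs
      rcases hs with hs | hs
      · have : xA k p ^ j = 0 := pow_eq_zero_of_le hs (xA_pow k p)
        simp [this]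
      · have : yA k p ^ i = 0 := pow_eq_zero_of_le hs (yA_pow k p)
        simp [this])
    hspan
    (by
      intro j i
      simp only [LinearMap.restrictScalars_apply, LinearMap.lsmul_apply, smul_eq_mul]
      ring)
  refine ⟨hfd, fun m => ?_⟩
  have := hrk m
  rw [restrict_pow] at this
  refine Eq.trans this ?_
  have : (Finset.range p ×ˢ Finset.range p).filter (fun s => m ≤ s.1)
      = Finset.Ico m p ×ˢ Finset.range p := by
    ext ⟨j, i⟩
    simp only [Finset.mem_filter, Finset.mem_product, Finset.mem_range, Finset.mem_Ico]
    tauto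
  rw [this]
  simp

theorem A_mul_smul {M : Type} [AddCommGroup M] [Module (Amod k p) M] (a b : Amod k p) (z : M) :
    (a * b) • z = a • b • z := mul_smul a b z

theorem A_zero_smul {M : Type} [AddCommGroup M] [Module (Amod k p) M] (z : M) :
    (0 : Amod k p) • z = 0 := zero_smul (Amod k p) z

theorem range_lsmul_pow_zero {A M : Type} [CommRing A] [AddCommGroup M] [Module A M] (a : A) :
    LinearMap.range (LinearMap.lsmul A M (a ^ 0)) = ⊤ := by
  rw [LinearMap.range_eq_top]
  intro z
  exact ⟨z, by simp⟩

theorem pointOp_pow [Fact p.Prime] [CharP k p] (u : Amod k p) (hu : IsPointOp k p u) :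
    u ^ p = 0 := by
  obtain ⟨α, β, -, rfl⟩ := hu
  have hA : CharP (MvPolynomial (Fin 2) k) p := inferInstance
  have h : (Ideal.Quotient.mk (relI k p)) ((α • X 0 + β • X 1) ^ p)
      = (α • xA k p + β • yA k p) ^ p := by
    rw [map_pow]
    rfl
  rw [← h]
  refine Ideal.Quotient.eq_zero_iff_mem.2 ?_
  rw [add_pow_char, smul_pow, smul_pow, smul_eq_C_mul, smul_eq_C_mul]
  exact add_mem (Ideal.mul_mem_left _ _ (Ideal.subset_span (by simp)))
    (Ideal.mul_mem_left _ _ (Ideal.subset_span (by simp)))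

theorem A_rank_u [Fact p.Prime] [CharP k p] (u : Amod k p) (hu : IsPointOp k p u) (m : ℕ) :
    finrank k (LinearMap.range (LinearMap.lsmul (Amod k p) (Amod k p) (u ^ m)))
      = (p - m) * p := by
  have hp : 1 ≤ p := (Fact.out : p.Prime).one_le
  obtain ⟨hfd, hrk⟩ := A_rank_x k p hp
  have hup := pointOp_pow k p u hu
  have : ∃ θ : Amod k p →ₐ[k] Amod k p, θ (xA k p) = u ∧ Function.Surjective θ := by
    obtain ⟨α, β, hab, rfl⟩ := hu
    have key : ∀ θ : Amod k p →ₐ[k] Amod k p, xA k p ∈ θ.range → yA k p ∈ θ.range →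
        Function.Surjective θ := by
      intro θ hx hy a
      refine A_induct k p (fun a => a ∈ θ.range) ?_ ?_ ?_ ?_ a
      · intro c; exact θ.range.algebraMap_mem c
      · intro a b ha hb; exact add_mem ha hb
      · intro a ha; exact mul_mem ha hx
      · intro a ha; exact mul_mem ha hy
    by_cases hα : α = 0
    · have hβ : β ≠ 0 := by tauto
      obtain ⟨θ, h1, h2⟩ := exists_lift k p (Amod k p) _ (xA k p) hup (xA_pow k p)
      refine ⟨θ, h1, key θ ⟨_, h2⟩ ?_⟩
      refine ⟨β⁻¹ • xA k p, ?_⟩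
      change θ _ = _
      rw [map_smul, h1, hα, zero_smul, zero_add, smul_smul, inv_mul_cancel₀ hβ, one_smul]
    · obtain ⟨θ, h1, h2⟩ := exists_lift k p (Amod k p) _ (yA k p) hup (yA_pow k p)
      refine ⟨θ, h1, key θ ?_ ⟨_, h2⟩⟩
      refine ⟨α⁻¹ • (xA k p - β • yA k p), ?_⟩
      change θ _ = _
      rw [map_smul, map_sub, map_smul, h1, h2, add_sub_cancel_right, smul_smul,
        inv_mul_cancel₀ hα, one_smul]
  obtain ⟨θ, hθ, hs⟩ := this
  have hi : Function.Injective θ.toLinearMap :=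
    LinearMap.injective_iff_surjective.2 hs
  have h := LinearEquiv.finrank_eq (Submodule.equivMapOfInjective θ.toLinearMap hi
    ((LinearMap.range (LinearMap.lsmul (Amod k p) (Amod k p) (xA k p ^ m))).restrictScalars k))
  have e : ((LinearMap.range (LinearMap.lsmul (Amod k p) (Amod k p) (xA k p ^ m))).restrictScalars k).map
      θ.toLinearMap
      = (LinearMap.range (LinearMap.lsmul (Amod k p) (Amod k p) (u ^ m))).restrictScalars k := by
    ext z
    constructor
    · rintro ⟨_, ⟨a, rfl⟩, rfl⟩
      exact ⟨θ a, by simp [hθ]⟩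
    · rintro ⟨b, rfl⟩
      obtain ⟨a, rfl⟩ := hs b
      exact ⟨_, ⟨a, rfl⟩, by simp [hθ]⟩
  rw [e] at h
  rw [← hrk m]
  exact h.symm

theorem A_pi_rank {A : Type} [CommRing A] [Algebra k A] [FiniteDimensional k A] (r : ℕ) (a : A) :
    finrank k (LinearMap.range (LinearMap.lsmul A (Fin r → A) a))
      = r * finrank k (LinearMap.range (LinearMap.lsmul A A a)) := by
  have : FiniteDimensional k (LinearMap.range (LinearMap.lsmul A A a)) :=
    inferInstanceAs (FiniteDimensional k ((LinearMap.range (LinearMap.lsmul A A a)).restrictScalars k))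
  have e : LinearMap.range (LinearMap.lsmul A (Fin r → A) a) ≃ₗ[k]
      (Fin r → LinearMap.range (LinearMap.lsmul A A a)) :=
    { toFun := fun z i => ⟨z.1 i, by
        obtain ⟨_, f, rfl⟩ := z
        exact ⟨f i, rfl⟩⟩
      invFun := fun z => ⟨fun i => (z i).1, by
        choose f hf using fun i => (z i).2
        exact ⟨f, funext hf⟩⟩
      left_inv := fun z => rfl
      right_inv := fun z => rfl
      map_add' := fun z w => rfl
      map_smul' := fun z w => rfl }
  rw [e.finrank_eq, Module.finrank_pi_fintype]
  simp

theorem A_pi_exact [Fact p.Prime] [CharP k p] (u : Amod k p) (hu : IsPointOp k p u)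
    (r j : ℕ) (hj : j ≤ p) :
    LinearMap.ker (LinearMap.lsmul (Amod k p) (Fin r → Amod k p) (u ^ j))
      = LinearMap.range (LinearMap.lsmul (Amod k p) (Fin r → Amod k p) (u ^ (p - j))) := by
  have hp : 1 ≤ p := (Fact.out : p.Prime).one_le
  obtain ⟨hfd, hrk⟩ := A_rank_x k p hp
  have hle : LinearMap.range (LinearMap.lsmul (Amod k p) (Fin r → Amod k p) (u ^ (p - j)))
    ≤ LinearMap.ker (LinearMap.lsmul (Amod k p) (Fin r → Amod k p) (u ^ j)) := by
    rintro _ ⟨f, rfl⟩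
    rw [LinearMap.mem_ker, LinearMap.lsmul_apply, LinearMap.lsmul_apply, smul_smul, ← pow_add,
      Nat.add_sub_cancel' hj, pointOp_pow k p u hu, A_zero_smul]
  have h1 := LinearMap.finrank_range_add_finrank_ker
    ((LinearMap.lsmul (Amod k p) (Fin r → Amod k p) (u ^ j)).restrictScalars k)
  have h2 : finrank k (LinearMap.range ((LinearMap.lsmul (Amod k p) (Fin r → Amod k p) (u ^ j)).restrictScalars k))
    = r * ((p - j) * p) := by
    rw [← A_rank_u k p u hu j, ← A_pi_rank]
    rfl
  have hA : finrank k (Amod k p) = p * p := by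
    have := hrk 0
    rw [range_lsmul_pow_zero, Nat.sub_zero] at this
    rw [← this]
    exact (finrank_top k (Amod k p)).symm
  have h3 : finrank k (Fin r → Amod k p) = r * (p * p) := by
    rw [Module.finrank_pi_fintype]; simp [hA]
  have h4 : finrank k (LinearMap.range (LinearMap.lsmul (Amod k p) (Fin r → Amod k p) (u ^ (p - j))))
      = r * (j * p) := by
    rw [A_pi_rank, A_rank_u k p u hu, Nat.sub_sub_self hj]
  rw [h2, h3] at h1
  have h5 := Submodule.eq_of_le_of_finrank_eq (K := k)
    (S₁ := (LinearMap.range (LinearMap.lsmul (Amod k p) (Fin r → Amod k p) (u ^ (p - j)))).restrictScalars k)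
    (S₂ := (LinearMap.ker (LinearMap.lsmul (Amod k p) (Fin r → Amod k p) (u ^ j))).restrictScalars k)
    hle (by
      refine Eq.trans h4 ?_
      change _ = finrank k (LinearMap.ker ((LinearMap.lsmul (Amod k p) (Fin r → Amod k p) (u ^ j)).restrictScalars k))
      have : r * ((p - j) * p) + r * (j * p) = r * (p * p) := by
        rw [← mul_add, ← add_mul, Nat.sub_add_cancel hj]
      omega)
  exact (Submodule.restrictScalars_injective k _ _ h5).symm

/-! ### the module `W` -/

/-- `v_i` extended by zero. -/
def vN (n i : ℕ) : Fin n → Amod k p := if h : i < n then stdV k p n ⟨i, h⟩ else 0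

/-- image of `v_i` in `W`. -/
def wN (n i : ℕ) : Wmod k p n p := (NSub k p n p).mkQ (vN k p n i)

theorem wN_zero (n i : ℕ) (h : n ≤ i) : wN k p n i = 0 := by
  rw [wN, vN, dif_neg (by omega), map_zero]

theorem x_vN (n : ℕ) : xA k p • vN k p n 0 ∈ NSub k p n p := by
  rw [vN]
  split_ifs with h
  · refine Submodule.subset_span (Or.inl (Or.inl (Or.inl ?_)))
    simp only [Set.mem_iUnion]
    exact ⟨⟨0, h⟩, rfl, rfl⟩
  · rw [smul_zero]; exact zero_mem _

theorem yx_vN (n i : ℕ) : yA k p • vN k p n i - xA k p • vN k p n (i + 1) ∈ NSub k p n p := by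
  rw [vN, vN]
  by_cases h : i + 1 < n
  · rw [dif_pos h, dif_pos (by omega)]
    refine Submodule.subset_span (Or.inr ?_)
    simp only [Set.mem_iUnion]
    exact ⟨⟨i, by omega⟩, ⟨i + 1, h⟩, rfl, rfl⟩
  · rw [dif_neg h, smul_zero, sub_zero]
    split_ifs with h'
    · refine Submodule.subset_span (Or.inl (Or.inl (Or.inr ?_)))
      simp only [Set.mem_iUnion]
      exact ⟨⟨i, h'⟩, by simp only; omega, rfl⟩
    · rw [smul_zero]; exact zero_mem _

theorem x_wN (n : ℕ) : xA k p • wN k p n 0 = 0 := by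
  rw [wN, ← map_smul]
  exact (Submodule.Quotient.mk_eq_zero _).2 (x_vN k p n)

theorem y_wN (n i : ℕ) : yA k p • wN k p n i = xA k p • wN k p n (i + 1) := by
  rw [← sub_eq_zero, wN, wN, ← map_smul, ← map_smul, ← map_sub]
  exact (Submodule.Quotient.mk_eq_zero _).2 (yx_vN k p n i)

theorem xpow_wN (n i j : ℕ) (h : i < j) : xA k p ^ j • wN k p n i = 0 := by
  induction i generalizing j with
  | zero =>
    obtain ⟨q, rfl⟩ := Nat.exists_eq_add_of_le' h
    rw [pow_succ, A_mul_smul, x_wN, smul_zero]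
  | succ i ih =>
    obtain ⟨q, rfl⟩ := Nat.exists_eq_add_of_le' (show 1 ≤ j by omega)
    rw [pow_succ, A_mul_smul, ← y_wN, smul_comm, ih q (by omega), smul_zero]

theorem span_wN (n : ℕ) : Submodule.span (Amod k p) (Set.range (wN k p n)) = ⊤ := by
  rw [eq_top_iff]
  rintro z -
  obtain ⟨f, rfl⟩ := Submodule.mkQ_surjective _ z
  rw [pi_eq_sum_univ' f, map_sum]
  refine Submodule.sum_mem _ fun i _ => ?_
  rw [map_smul]
  refine Submodule.smul_mem _ _ (Submodule.subset_span ⟨i.1, ?_⟩)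
  rw [wN, vN, dif_pos i.2]
  rfl

theorem W_range_u (n : ℕ) (u : Amod k p) (hu : IsPointOp k p u) :
    LinearMap.range (LinearMap.lsmul (Amod k p) (Wmod k p n p) u)
      = LinearMap.range (LinearMap.lsmul (Amod k p) (Wmod k p n p) (xA k p)) := by
  obtain ⟨α, β, hab, hu⟩ := hu
  have hxu : ∀ i, α • (xA k p • wN k p n i) + β • (xA k p • wN k p n (i + 1)) = u • wN k p n i := by
    intro i
    rw [hu, add_smul, smul_assoc, smul_assoc, y_wN]
  apply le_antisymm
  · rw [LinearMap.range_eq_map, ← span_wN, Submodule.map_span, Submodule.span_le]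
    rintro _ ⟨_, ⟨i, rfl⟩, rfl⟩
    rw [LinearMap.lsmul_apply, ← hxu]
    refine ⟨α • wN k p n i + β • wN k p n (i + 1), ?_⟩
    rw [map_add, LinearMap.lsmul_apply, LinearMap.lsmul_apply, smul_comm, smul_comm _ β]
  · rw [LinearMap.range_eq_map (LinearMap.lsmul (Amod k p) (Wmod k p n p) (xA k p)), ← span_wN,
      Submodule.map_span, Submodule.span_le]
    rintro _ ⟨_, ⟨i, rfl⟩, rfl⟩
    rw [LinearMap.lsmul_apply]
    by_cases hβ : β = 0
    · have hα : α ≠ 0 := by tauto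
      refine ⟨α⁻¹ • wN k p n i, ?_⟩
      rw [LinearMap.lsmul_apply, smul_comm, ← hxu, hβ, zero_smul, add_zero, smul_smul,
        inv_mul_cancel₀ hα, one_smul]
    · have hsm : ∀ (c : k) (z : Wmod k p n p),
          z ∈ LinearMap.range (LinearMap.lsmul (Amod k p) (Wmod k p n p) u) →
          c • z ∈ LinearMap.range (LinearMap.lsmul (Amod k p) (Wmod k p n p) u) := by
        rintro c _ ⟨z, rfl⟩
        exact ⟨c • z, by rw [LinearMap.lsmul_apply, LinearMap.lsmul_apply, smul_comm]⟩
      induction i with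
      | zero => rw [x_wN]; exact zero_mem _
      | succ i ih =>
        have : xA k p • wN k p n (i + 1) = β⁻¹ • (u • wN k p n i - α • (xA k p • wN k p n i)) := by
          rw [← hxu, add_sub_cancel_left, smul_smul, inv_mul_cancel₀ hβ, one_smul]
        rw [this]
        exact hsm _ _ (sub_mem ⟨_, rfl⟩ (hsm _ _ ih))

theorem W_range_upow (n : ℕ) (u : Amod k p) (hu : IsPointOp k p u) (m : ℕ) :
    LinearMap.range (LinearMap.lsmul (Amod k p) (Wmod k p n p) (u ^ m))
      = LinearMap.range (LinearMap.lsmul (Amod k p) (Wmod k p n p) (xA k p ^ m)) := by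
  induction m with
  | zero => simp
  | succ m ih =>
    ext z
    constructor
    · rintro ⟨w, rfl⟩
      obtain ⟨w', hw'⟩ : u • w ∈ LinearMap.range (LinearMap.lsmul (Amod k p) (Wmod k p n p) (xA k p)) := by
        rw [← W_range_u k p n u hu]; exact ⟨w, rfl⟩
      obtain ⟨w'', hw''⟩ : u ^ m • w' ∈
          LinearMap.range (LinearMap.lsmul (Amod k p) (Wmod k p n p) (xA k p ^ m)) := by
        rw [← ih]; exact ⟨w', rfl⟩
      refine ⟨w'', ?_⟩
      simp only [LinearMap.lsmul_apply] at *
      rw [pow_succ', A_mul_smul, hw'', pow_succ, A_mul_smul, ← hw', smul_comm]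
    · rintro ⟨w, rfl⟩
      obtain ⟨w', hw'⟩ : xA k p • w ∈ LinearMap.range (LinearMap.lsmul (Amod k p) (Wmod k p n p) u) := by
        rw [W_range_u k p n u hu]; exact ⟨w, rfl⟩
      obtain ⟨w'', hw''⟩ : xA k p ^ m • w' ∈
          LinearMap.range (LinearMap.lsmul (Amod k p) (Wmod k p n p) (u ^ m)) := by
        rw [ih]; exact ⟨w', rfl⟩
      refine ⟨w'', ?_⟩
      simp only [LinearMap.lsmul_apply] at *
      rw [pow_succ', A_mul_smul, hw'', pow_succ, A_mul_smul, ← hw', smul_comm]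

theorem exists_PhiW (hp : 1 ≤ p) (n : ℕ) : ∃ Φ : Wmod k p n p →ₗ[k] (ℕ × ℕ → k),
    ∀ j i, j < p → j ≤ i → i < n → Φ (xA k p ^ j • wN k p n i) = Pi.single (j, i) 1 := by
  classical
  let P : ℕ × ℕ → Prop := fun s => 1 ≤ s.1 ∧ s.1 ≤ s.2 ∧ s.1 < p ∧ s.2 < n
  obtain ⟨ρ, hx, hy⟩ := exists_rep k p (ℕ × ℕ → k)
    (Sh k P (fun s => (s.1 - 1, s.2)))
    (Sh k P (fun s => (s.1 - 1, s.2 - 1)))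
    (by
      apply LinearMap.ext
      intro g
      ext ⟨j, i⟩
      simp only [Module.End.mul_apply, Sh_apply, P]
      split_ifs <;> first | rfl | omega)
    (Sh_pow k p hp _ _ (fun s => s.1) (by intro s hs; dsimp only [P] at *; omega))
    (Sh_pow k p hp _ _ (fun s => s.1) (by intro s hs; dsimp only [P] at *; omega))
  let instM : Module (Amod k p) (ℕ × ℕ → k) := Module.compHom _ ρ.toRingHom
  have hsm : ∀ (a : Amod k p) (g : ℕ × ℕ → k), a • g = ρ a g := fun _ _ => rfl
  have instT : IsScalarTower k (Amod k p) (ℕ × ℕ → k) := ⟨fun c a g => by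
    rw [hsm, hsm, map_smul, LinearMap.smul_apply]⟩
  let Ψ : (Fin n → Amod k p) →ₗ[Amod k p] (ℕ × ℕ → k) :=
    Fintype.linearCombination (Amod k p) (fun i : Fin n => (Pi.single (0, i.1) 1 : ℕ × ℕ → k))
  have hΨ : ∀ i, Ψ (stdV k p n i) = Pi.single (0, i.1) 1 := by
    intro i
    simp only [Ψ, stdV]
    rw [Fintype.linearCombination_apply_single, one_smul]
  have hker : NSub k p n p ≤ LinearMap.ker Ψ := by
    rw [NSub, Submodule.span_le]
    rintro z (((hz | hz) | hz) | hz)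
    · simp only [Set.mem_iUnion] at hz
      obtain ⟨i, hi, rfl⟩ := hz
      change Ψ _ = 0
      rw [map_smul, hΨ, hsm, hx]
      apply Sh_single_zero
      rintro ⟨a, b⟩ hP
      dsimp only [P] at hP
      simp only [ne_eq, Prod.mk.injEq]
      omega
    · simp only [Set.mem_iUnion] at hz
      obtain ⟨i, hi, rfl⟩ := hz
      change Ψ _ = 0
      rw [map_smul, hΨ, hsm, hy]
      apply Sh_single_zero
      rintro ⟨a, b⟩ hP
      dsimp only [P] at hP
      simp only [ne_eq, Prod.mk.injEq]
      omega
    · simp only [Set.mem_iUnion] at hz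
      obtain ⟨i, hi, rfl⟩ := hz
      rw [xA_pow, A_zero_smul]
      exact zero_mem _
    · simp only [Set.mem_iUnion] at hz
      obtain ⟨i, j, hij, rfl⟩ := hz
      change Ψ _ = 0
      rw [map_sub, map_smul, map_smul, hΨ, hΨ, hsm, hsm, hx, hy, sub_eq_zero]
      ext ⟨a, b⟩
      simp only [Sh_apply, Pi.single_apply, P, Prod.mk.injEq]
      split_ifs <;> first | rfl | omega
  refine ⟨((NSub k p n p).liftQ Ψ hker).restrictScalars k, ?_⟩
  intro j i hj hji hi
  rw [LinearMap.restrictScalars_apply, map_smul, wN, Submodule.mkQ_apply, Submodule.liftQ_apply, vN,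
    dif_pos hi, hΨ, hsm]
  dsimp only
  induction j with
  | zero => simp
  | succ j ih =>
    rw [pow_succ', map_mul, Module.End.mul_apply, ih (by omega) (by omega), hx]
    apply Sh_single
    rintro ⟨a, b⟩
    simp only [Prod.mk.injEq, P]
    omega

theorem W_rank_x (hp : 1 ≤ p) (n : ℕ) : FiniteDimensional k (Wmod k p n p) ∧
    ∀ m, finrank k (LinearMap.range (LinearMap.lsmul (Amod k p) (Wmod k p n p) (xA k p ^ m)))
      = ∑ j ∈ Finset.Ico m p, (n - j) := by
  classical
  obtain ⟨Φ, hΦ⟩ := exists_PhiW k p hp n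
  have hspan : Submodule.span k (Set.range fun s : ℕ × ℕ => xA k p ^ s.1 • wN k p n s.2) = ⊤ := by
    set B := Submodule.span k (Set.range fun s : ℕ × ℕ => xA k p ^ s.1 • wN k p n s.2) with hB
    have hBx : ∀ z ∈ B, xA k p • z ∈ B := by
      intro z hz
      refine Submodule.span_induction ?_ ?_ ?_ ?_ hz
      · rintro _ ⟨⟨j, i⟩, rfl⟩
        exact Submodule.subset_span ⟨(j + 1, i), by simp only [pow_succ', A_mul_smul]⟩
      · rw [smul_zero]; exact zero_mem _
      · intro a b _ _ ha hb; rw [smul_add]; exact add_mem ha hb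
      · intro c a _ ha; rw [smul_comm]; exact Submodule.smul_mem _ _ ha
    have hBy : ∀ z ∈ B, yA k p • z ∈ B := by
      intro z hz
      refine Submodule.span_induction ?_ ?_ ?_ ?_ hz
      · rintro _ ⟨⟨j, i⟩, rfl⟩
        refine Submodule.subset_span ⟨(j + 1, i + 1), ?_⟩
        simp only
        rw [smul_comm, y_wN, pow_succ, A_mul_smul]
      · rw [smul_zero]; exact zero_mem _
      · intro a b _ _ ha hb; rw [smul_add]; exact add_mem ha hb
      · intro c a _ ha; rw [smul_comm]; exact Submodule.smul_mem _ _ ha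
    have hBA : ∀ a : Amod k p, ∀ z ∈ B, a • z ∈ B := by
      intro a
      refine A_induct k p (fun a => ∀ z ∈ B, a • z ∈ B) ?_ ?_ ?_ ?_ a
      · intro c z hz; rw [algebraMap_smul]; exact Submodule.smul_mem _ _ hz
      · intro a b ha hb z hz; rw [add_smul]; exact add_mem (ha z hz) (hb z hz)
      · intro a ha z hz; rw [A_mul_smul]; exact ha _ (hBx z hz)
      · intro a ha z hz; rw [A_mul_smul]; exact ha _ (hBy z hz)
    rw [eq_top_iff]
    rintro z -
    have hz : z ∈ Submodule.span (Amod k p) (Set.range (wN k p n)) := by rw [span_wN]; trivial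
    refine Submodule.span_induction ?_ ?_ ?_ ?_ hz
    · rintro _ ⟨i, rfl⟩
      exact Submodule.subset_span ⟨(0, i), by simp⟩
    · exact zero_mem _
    · intro a b _ _ ha hb; exact add_mem ha hb
    · intro c a _ ha; exact hBA c a ha
  obtain ⟨hfd, hrk⟩ := shift_family
    ((LinearMap.lsmul (Amod k p) (Wmod k p n p) (xA k p)).restrictScalars k)
    (fun s : ℕ × ℕ => xA k p ^ s.1 • wN k p n s.2)
    ((Finset.range p ×ˢ Finset.range n).filter (fun s => s.1 ≤ s.2))
    Φ
    (by
      rintro ⟨j, i⟩ hs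
      simp only [Finset.mem_filter, Finset.mem_product, Finset.mem_range] at hs
      exact hΦ j i hs.1.1 hs.2 hs.1.2)
    (by
      rintro ⟨j, i⟩ hs
      simp only [Finset.mem_filter, Finset.mem_product, Finset.mem_range, not_and_or, not_lt,
        not_le] at hs
      rcases hs with (hs | hs) | hs
      · have : xA k p ^ j = 0 := pow_eq_zero_of_le hs (xA_pow k p)
        simp only [this, A_zero_smul]
      · simp only [wN_zero k p n i hs, smul_zero]
      · exact xpow_wN k p n i j hs)
    hspan
    (by
      intro j i
      simp only [LinearMap.restrictScalars_apply, LinearMap.lsmul_apply, pow_succ', A_mul_smul])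
  refine ⟨hfd, fun m => ?_⟩
  have := hrk m
  rw [restrict_pow] at this
  refine Eq.trans this ?_
  have : ((Finset.range p ×ˢ Finset.range n).filter (fun s => s.1 ≤ s.2)).filter (fun s => m ≤ s.1)
      = ((Finset.Ico m p).sigma (fun j => Finset.Ico j n)).map
        (Equiv.sigmaEquivProd ℕ ℕ).toEmbedding := by
    ext ⟨j, i⟩
    simp only [Finset.mem_filter, Finset.mem_product, Finset.mem_range, Finset.mem_map,
      Finset.mem_sigma, Finset.mem_Ico, Equiv.coe_toEmbedding, Equiv.sigmaEquivProd_apply,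
      Prod.mk.injEq, Sigma.exists]
    constructor
    · intro h
      exact ⟨j, i, by omega, rfl, rfl⟩
    · rintro ⟨j, i, h, rfl, rfl⟩
      omega
  rw [this, Finset.card_map, Finset.card_sigma]
  simp

/-! ### The presentation of `W` -/

/-- The relation map `A^{n+1} → A^n`. -/
def relMap (n : ℕ) : (Fin (n + 1) → Amod k p) →ₗ[Amod k p] (Fin n → Amod k p) where
  toFun a i := yA k p * a i.succ - xA k p * a i.castSucc
  map_add' a b := by ext i; simp only [Pi.add_apply]; ring
  map_smul' c a := by
    ext i
    simp only [Pi.smul_apply, smul_eq_mul, RingHom.id_apply]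
    ring

theorem relMap_apply (n : ℕ) (a : Fin (n + 1) → Amod k p) (i : Fin n) :
    relMap k p n a i = yA k p * a i.succ - xA k p * a i.castSucc := rfl

theorem vN_apply (n i : ℕ) (j : Fin n) : vN k p n i j = if j.val = i then 1 else 0 := by
  rw [vN]
  split_ifs with h1 h2 h2
  · rw [stdV, Pi.single_apply, if_pos (Fin.ext h2)]
  · rw [stdV, Pi.single_apply, if_neg (fun h => h2 (congrArg Fin.val h))]
  · exact absurd j.2 (by omega)
  · rfl

theorem relMap_zero (n : ℕ) : relMap k p n (Pi.single 0 1) = - (xA k p • vN k p n 0) := by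
  ext j
  rw [relMap_apply, Pi.neg_apply, Pi.smul_apply, vN_apply, Pi.single_apply, Pi.single_apply,
    if_neg (Fin.succ_ne_zero j), smul_eq_mul, mul_zero, zero_sub]
  simp only [Fin.ext_iff, Fin.val_castSucc, Fin.val_zero]

theorem relMap_succ (n : ℕ) (i : Fin n) : relMap k p n (Pi.single i.succ 1)
    = yA k p • vN k p n i - xA k p • vN k p n (i + 1) := by
  ext j
  rw [relMap_apply, Pi.sub_apply, Pi.smul_apply, Pi.smul_apply, vN_apply, vN_apply,
    Pi.single_apply, Pi.single_apply, smul_eq_mul, smul_eq_mul]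
  simp only [Fin.ext_iff, Fin.val_castSucc, Fin.val_succ, Nat.add_right_cancel_iff]

theorem relMap_range (n : ℕ) : LinearMap.range (relMap k p n) = NSub k p n p := by
  apply le_antisymm
  · rintro _ ⟨a, rfl⟩
    rw [pi_eq_sum_univ' a, map_sum]
    refine Submodule.sum_mem _ fun l _ => ?_
    rw [map_smul]
    refine Submodule.smul_mem _ _ ?_
    change relMap k p n (Pi.single l 1) ∈ _
    refine Fin.cases ?_ (fun i => ?_) l
    · rw [relMap_zero]; exact neg_mem (x_vN k p n)
    · rw [relMap_succ]; exact yx_vN k p n i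
  · have hv : ∀ i : Fin n, stdV k p n i = vN k p n i := by
      intro i; rw [vN, dif_pos i.2]
    have hR : ∀ i : Fin n, yA k p • vN k p n i - xA k p • vN k p n (i + 1)
        ∈ LinearMap.range (relMap k p n) := fun i => ⟨_, relMap_succ k p n i⟩
    rw [NSub, Submodule.span_le]
    rintro z (((hz | hz) | hz) | hz)
    · simp only [Set.mem_iUnion] at hz
      obtain ⟨i, hi, rfl⟩ := hz
      refine ⟨-Pi.single 0 1, ?_⟩
      rw [map_neg, relMap_zero, neg_neg, hv, hi]
    · simp only [Set.mem_iUnion] at hz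
      obtain ⟨i, hi, rfl⟩ := hz
      have h := hR i
      have h0 : vN k p n (i + 1) = 0 := by
        rw [vN, dif_neg (by omega)]
      rw [h0, smul_zero, sub_zero, ← hv] at h
      exact h
    · simp only [Set.mem_iUnion] at hz
      obtain ⟨i, hi, rfl⟩ := hz
      rw [xA_pow, A_zero_smul]
      exact zero_mem _
    · simp only [Set.mem_iUnion] at hz
      obtain ⟨i, j, hij, rfl⟩ := hz
      have h := hR i
      rw [← hij, ← hv, ← hv] at h
      exact h

theorem mem_mA_smul (r : ℕ) (a : Fin r → Amod k p) (h : ∀ i, a i ∈ mA k p) :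
    a ∈ mA k p • (⊤ : Submodule (Amod k p) (Fin r → Amod k p)) := by
  rw [pi_eq_sum_univ' a]
  exact Submodule.sum_mem _ fun l _ => Submodule.smul_mem_smul (h l) trivial

theorem relMap_ker (hp : 2 ≤ p) (n : ℕ) (hn : 1 ≤ n) : LinearMap.ker (relMap k p n)
    ≤ mA k p • (⊤ : Submodule (Amod k p) (Fin (n + 1) → Amod k p)) := by
  intro a ha
  have h : ∀ i : Fin n, a i.succ ∈ mA k p ∧ a i.castSucc ∈ mA k p := by
    intro i
    apply rel_mem k p hp
    have := congrFun (LinearMap.mem_ker.1 ha) i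
    rw [relMap_apply] at this
    exact sub_eq_zero.1 this
  apply mem_mA_smul
  intro l
  refine Fin.cases ?_ (fun i => (h i).1) l
  exact (h ⟨0, hn⟩).2

theorem NSub_le (n : ℕ) : NSub k p n p
    ≤ mA k p • (⊤ : Submodule (Amod k p) (Fin n → Amod k p)) := by
  rw [← relMap_range]
  rintro _ ⟨a, rfl⟩
  apply mem_mA_smul
  intro i
  rw [relMap_apply]
  exact sub_mem (Ideal.mul_mem_right _ _ (Ideal.subset_span (by simp)))
    (Ideal.mul_mem_right _ _ (Ideal.subset_span (by simp)))

theorem sum_identity (p n j : ℕ) (hp : 1 ≤ p) (hn : p ≤ n) (hj : j ≤ p) :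
    ∑ i ∈ Finset.Icc (j + 1) p, (i - j) * (if 1 ≤ i ∧ i ≤ p - 1 then 1
        else if i = p then n + 1 else 0)
      = (p - j) * p + ∑ i ∈ Finset.Ico j p, (n - i) := by
  obtain ⟨d, rfl⟩ := Nat.exists_eq_add_of_le hj
  obtain ⟨e, rfl⟩ := Nat.exists_eq_add_of_le hn
  rcases Nat.eq_zero_or_pos d with rfl | hd
  · simp
  obtain ⟨c, rfl⟩ := Nat.exists_eq_add_of_le' hd
  have h1 : Finset.Icc (j + 1) (j + (c + 1)) = Finset.Ico (j + 1) (j + 1 + c + 1) := by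
    ext; simp only [Finset.mem_Icc, Finset.mem_Ico]; omega
  rw [h1, Finset.sum_Ico_succ_top (by omega)]
  have h2 : ∑ i ∈ Finset.Ico (j + 1) (j + 1 + c), (i - j) * (if 1 ≤ i ∧ i ≤ j + (c + 1) - 1 then 1
        else if i = j + (c + 1) then (j + (c + 1) + e) + 1 else 0) = ∑ i ∈ Finset.range c, (i + 1) := by
    rw [Finset.sum_Ico_eq_sum_range]
    rw [show j + 1 + c - (j + 1) = c by omega]
    apply Finset.sum_congr rfl
    intro i hi
    rw [Finset.mem_range] at hi
    rw [if_pos (by omega), mul_one]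
    omega
  have h3 : ∑ i ∈ Finset.Ico j (j + (c + 1)), (j + (c + 1) + e - i)
      = ∑ i ∈ Finset.range (c + 1), (e + i + 1) := by
    rw [Finset.sum_Ico_eq_sum_range, show j + (c + 1) - j = c + 1 by omega,
      ← Finset.sum_range_reflect]
    apply Finset.sum_congr rfl
    intro i hi
    rw [Finset.mem_range] at hi
    omega
  rw [h2, h3, if_neg (by omega), if_pos (by omega), show j + 1 + c - j = c + 1 by omega,
    show j + (c + 1) - j = c + 1 by omega]
  have h4 : ∀ c : ℕ, ∑ i ∈ Finset.range (c + 1), (e + i + 1)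
      = (c + 1) * (e + 1) + ∑ i ∈ Finset.range c, (i + 1) := by
    intro c
    induction c with
    | zero => simp
    | succ c ih => rw [Finset.sum_range_succ, ih, Finset.sum_range_succ]; ring
  rw [h4]
  ring

theorem finrank_range_transfer {K A M N : Type} [Field K] [CommRing A] [Algebra K A]
    [AddCommGroup N] [Module A N] [Module K N] [IsScalarTower K A N]
    [AddCommGroup M] [Module A M] [Module K M] [IsScalarTower K A M]
    (e : N ≃ₗ[A] M) (a : A) :
    finrank K (LinearMap.range (LinearMap.lsmul A N a))
      = finrank K (LinearMap.range (LinearMap.lsmul A M a)) := by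
  have h : (LinearMap.range (LinearMap.lsmul A N a)).map (e : N →ₗ[A] M)
      = LinearMap.range (LinearMap.lsmul A M a) := by
    ext z
    constructor
    · rintro ⟨_, ⟨f, rfl⟩, rfl⟩
      exact ⟨e f, by simp⟩
    · rintro ⟨m, rfl⟩
      exact ⟨_, ⟨e.symm m, rfl⟩, by simp⟩
  have e2 := (e.submoduleMap (LinearMap.range (LinearMap.lsmul A N a))).restrictScalars K
  rw [e2.finrank_eq]
  change finrank K ((LinearMap.range (LinearMap.lsmul A N a)).map (e : N →ₗ[A] M)) = _
  rw [h]

theorem finrank_ker_aux {K A F M : Type} [Field K] [CommRing A] [Algebra K A]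
    [AddCommGroup F] [Module A F] [Module K F] [IsScalarTower K A F] [FiniteDimensional K F]
    [AddCommGroup M] [Module A M] [Module K M] [IsScalarTower K A M]
    (g : F →ₗ[A] M) (hg : Function.Surjective g) :
    finrank K M + finrank K (LinearMap.ker g) = finrank K F := by
  have h := LinearMap.finrank_range_add_finrank_ker (g.restrictScalars K)
  rw [LinearMap.range_eq_top.2 (show Function.Surjective (g.restrictScalars K) from hg),
    finrank_top] at h
  exact h

/-- The main computation. -/
theorem syz_ranks [Fact p.Prime] [CharP k p] (n : ℕ) (hn : p ≤ n)
    (N : Type) [AddCommGroup N] [Module (Amod k p) N]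
    [Module k N] [IsScalarTower k (Amod k p) N]
    {r s : ℕ} (g : (Fin r → Amod k p) →ₗ[Amod k p] Wmod k p n p) (hg : Function.Surjective g)
    (hg' : LinearMap.ker g ≤ mA k p • (⊤ : Submodule (Amod k p) (Fin r → Amod k p)))
    (f : (Fin s → Amod k p) →ₗ[Amod k p] LinearMap.ker g) (hf : Function.Surjective f)
    (hf' : LinearMap.ker f ≤ mA k p • (⊤ : Submodule (Amod k p) (Fin s → Amod k p)))
    (e : N ≃ₗ[Amod k p] LinearMap.ker f) :
    finrank k N = p * p + ∑ i ∈ Finset.Ico 0 p, (n - i) ∧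
    ∀ u : Amod k p, IsPointOp k p u → ∀ j ≤ p,
      finrank k (LinearMap.range (LinearMap.lsmul (Amod k p) N (u ^ j)))
        = (p - j) * p + ∑ i ∈ Finset.Ico j p, (n - i) := by
  have hp2 : 2 ≤ p := (Fact.out : p.Prime).two_le
  have hp : 1 ≤ p := by omega
  obtain ⟨hfdA, hrkA⟩ := A_rank_x k p hp
  obtain ⟨hfdW, hrkW⟩ := W_rank_x k p hp n
  have hA : finrank k (Amod k p) = p * p := by
    have := hrkA 0
    rw [range_lsmul_pow_zero, Nat.sub_zero] at this
    rw [← this]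
    exact (finrank_top k (Amod k p)).symm
  have hW : finrank k (Wmod k p n p) = ∑ i ∈ Finset.Ico 0 p, (n - i) := by
    have := hrkW 0
    rw [range_lsmul_pow_zero] at this
    rw [← this]
    exact (finrank_top k (Wmod k p n p)).symm
  have hnt : Nontrivial (Amod k p) := by
    apply Module.nontrivial_of_finrank_pos (R := k)
    rw [hA]; positivity
  have hF : ∀ r : ℕ, finrank k (Fin r → Amod k p) = r * (p * p) := by
    intro r; rw [Module.finrank_pi_fintype]; simp [hA]
  obtain ⟨hr, ⟨e1⟩⟩ := cover_unique (mA k p) (mA_le_jac k p) g (NSub k p n p).mkQ hg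
    (Submodule.mkQ_surjective _) hg' (by rw [Submodule.ker_mkQ]; exact NSub_le k p n)
  subst hr
  let e2 : LinearMap.ker g ≃ₗ[Amod k p] LinearMap.range (relMap k p r) :=
    e1.trans (LinearEquiv.ofEq _ _ (by rw [Submodule.ker_mkQ, relMap_range]))
  obtain ⟨hs, -⟩ := cover_unique (mA k p) (mA_le_jac k p)
    ((e2 : LinearMap.ker g →ₗ[Amod k p] LinearMap.range (relMap k p r)) ∘ₗ f)
    (relMap k p r).rangeRestrict
    (e2.surjective.comp hf) (LinearMap.surjective_rangeRestrict _)
    (by rw [LinearEquiv.ker_comp]; exact hf')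
    (by rw [LinearMap.ker_rangeRestrict]; exact relMap_ker k p hp2 r (by omega))
  subst hs
  have d1 := finrank_ker_aux (K := k) g hg
  have d2 := finrank_ker_aux (K := k) f hf
  have dN : finrank k N = finrank k (LinearMap.ker f) := (e.restrictScalars k).finrank_eq
  rw [hF] at d1 d2
  rw [hW] at d1
  have hrr : (r + 1) * (p * p) = r * (p * p) + p * p := by ring
  refine ⟨by omega, ?_⟩
  intro u hu j hj
  rw [finrank_range_transfer e]
  have r1 := rank_formula_aux (K := k) f hf (u ^ j) (u ^ (p - j)) (A_pi_exact k p u hu _ j hj)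
  have r2 := rank_formula_aux (K := k) g hg (u ^ (p - j)) (u ^ (p - (p - j)))
    (A_pi_exact k p u hu _ (p - j) (by omega))
  rw [Nat.sub_sub_self hj, W_range_upow k p r u hu, hrkW] at r2
  rw [A_pi_rank, A_rank_u k p u hu] at r1 r2
  rw [Nat.sub_sub_self hj] at r1
  have a1 : r * ((p - j) * p) + (r + 1) * (j * p) + (p - j) * p = (r + 1) * (p * p) := by
    obtain ⟨c, rfl⟩ := Nat.exists_eq_add_of_le hj
    rw [Nat.add_sub_cancel_left]; ring
  omega

/-- for `n ≥ p`, every minimal second syzygy of `W_{n,p}` has constant Jordan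
type `⊕_{i=1}^{p−1}[i] ⊕ (n+1)[p]`. -/
theorem minSecondSyz_Wnp_constantJordanType
    [IsAlgClosed k] [Fact p.Prime] [CharP k p]
    (n : ℕ) (hn : p ≤ n)
    (N : Type) [AddCommGroup N] [Module (Amod k p) N]
    [Module k N] [IsScalarTower k (Amod k p) N] [FiniteDimensional k N]
    (hN : IsMinSyz k p 2 (ModuleCat.of (Amod k p) N) (ModuleCat.of (Amod k p) (Wmod k p n p))) :
    ConstantJordanType k p
      (fun i => if 1 ≤ i ∧ i ≤ p - 1 then 1
        else if i = p then n + 1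
        else 0) N := by

  obtain ⟨r, g, hg, hg', s, f, hf, hf', ⟨e⟩⟩ := hN
  have hp : 1 ≤ p := (Fact.out : p.Prime).one_le
  obtain ⟨h1, h2⟩ := syz_ranks k p n hn N g hg hg' f hf hf' e
  refine ⟨?_, ?_⟩
  · rw [h1]
    have := sum_identity p n 0 hp hn (by omega)
    simp only [Nat.sub_zero, zero_add] at this
    exact this.symm
  · intro u hu j hj1 hj2
    rw [lsmul_pow_eq, h2 u hu j (by omega)]
    exact (sum_identity p n j hp hn (by omega)).symm

end
end

section
/- Let M be an A-module with the equal images property, and set a_1(M) := dim_k M − 2·dim_k 𝔪M + dim_k 𝔪²M (the number of Jordan blocks of size 1 of any point operator acting on M). Then the A-module M/𝔪²M is indecomposable if and only if a_1(M) = 1. -/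
open MvPolynomial Module

set_option maxHeartbeats 1000000
set_option synthInstance.maxHeartbeats 400000

noncomputable section

variable (k : Type) [Field k] (p : ℕ)

theorem kron_dim {k : Type} [Field k] [IsAlgClosed k] {V W : Type} [AddCommGroup V] [Module k V]
    [AddCommGroup W] [Module k W] [FiniteDimensional k V] [FiniteDimensional k W]
    (x y : V →ₗ[k] W)
    (h : ∀ α β : k, (α ≠ 0 ∨ β ≠ 0) → Function.Surjective (α • x + β • y))
    (hV : Nontrivial V) : finrank k W + 1 ≤ finrank k V := by
  have hx : Function.Surjective x := by simpa using h 1 0 (by simp)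
  have hle : finrank k W ≤ finrank k V := LinearMap.finrank_le_finrank_of_surjective hx
  by_contra hlt
  have heq : finrank k V = finrank k W := by omega
  have hxi : Function.Injective x := (LinearMap.injective_iff_surjective_of_finrank_eq_finrank heq).2 hx
  let e : V ≃ₗ[k] W := LinearEquiv.ofBijective x ⟨hxi, hx⟩
  obtain ⟨μ, hμ⟩ := Module.End.exists_eigenvalue (e.symm.toLinearMap ∘ₗ y)
  obtain ⟨v, hv⟩ := hμ.exists_hasEigenvector
  have h1 : e.symm (y v) = μ • v := hv.apply_eq_smul
  have h2 : y v = μ • x v := by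
    have := congrArg e h1
    rw [map_smul, LinearEquiv.apply_symm_apply] at this
    exact this
  have hs := h (-μ) 1 (by simp)
  have hi := (LinearMap.injective_iff_surjective_of_finrank_eq_finrank heq).2 hs
  apply hv.2
  apply hi
  simp [h2]

theorem kron_decomp {k : Type} [Field k] (n : ℕ) : ∀ (V W : Type) [AddCommGroup V] [Module k V]
    [AddCommGroup W] [Module k W] [FiniteDimensional k V] [FiniteDimensional k W]
    (x y : V →ₗ[k] W)
    (_ : ∀ α β : k, (α ≠ 0 ∨ β ≠ 0) → Function.Surjective (α • x + β • y))
    (_ : finrank k W + 2 ≤ finrank k V) (_ : finrank k W ≤ n),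
    ∃ (V₁ V₂ : Submodule k V) (W₁ W₂ : Submodule k W), IsCompl V₁ V₂ ∧ IsCompl W₁ W₂ ∧
      (∀ v ∈ V₁, x v ∈ W₁ ∧ y v ∈ W₁) ∧ (∀ v ∈ V₂, x v ∈ W₂ ∧ y v ∈ W₂) ∧ V₁ ≠ ⊥ ∧ V₂ ≠ ⊥ := by
  induction n using Nat.strong_induction_on with | _ n ih => ?_
  intro V W _ _ _ _ _ _ x y h hdim hn
  by_cases hker : ∃ v : V, v ≠ 0 ∧ x v = 0 ∧ y v = 0
  · obtain ⟨v, hv0, hxv, hyv⟩ := hker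
    obtain ⟨V₂, hV₂⟩ := Submodule.exists_isCompl (Submodule.span k {v})
    refine ⟨_, V₂, ⊥, ⊤, hV₂, isCompl_bot_top, ?_, by simp, by simpa using hv0, ?_⟩
    · intro w hw
      obtain ⟨c, rfl⟩ := Submodule.mem_span_singleton.1 hw
      simp [hxv, hyv]
    · rintro rfl
      have := Submodule.finrank_add_eq_of_isCompl hV₂
      rw [finrank_span_singleton hv0, finrank_bot] at this
      omega
  have hinj : ∀ v : V, x v = 0 → y v = 0 → v = 0 := by
    intro v h1 h2
    by_contra h3
    exact hker ⟨v, h3, h1, h2⟩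
  let φ : V →ₗ[k] W × W := x.prod y
  have hφ : Function.Injective φ := by
    rw [injective_iff_map_eq_zero]
    intro v hv
    have : x v = 0 ∧ y v = 0 := by simpa [φ, Prod.ext_iff] using hv
    exact hinj v this.1 this.2
  have hr := LinearMap.finrank_range_of_inj hφ
  have hq := Submodule.finrank_quotient_add_finrank (LinearMap.range φ)
  rw [finrank_prod, hr] at hq
  let q := (LinearMap.range φ).mkQ
  let i₁ : W →ₗ[k] ((W × W) ⧸ LinearMap.range φ) := q ∘ₗ LinearMap.inl k W W
  let i₂ : W →ₗ[k] ((W × W) ⧸ LinearMap.range φ) := q ∘ₗ LinearMap.inr k W W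
  have hq12 : ∀ a b, i₁ a + i₂ b = q (a, b) := by
    intro a b
    simp only [i₁, i₂, LinearMap.comp_apply, ← map_add]
    simp
  obtain ⟨W₁, W₂, C₁, C₂, hW, hC, h1, h2, hn1, hn2⟩ := ih _ (by omega : finrank k ((W × W) ⧸ LinearMap.range φ) < n) W _ i₁ i₂ (by
    intro α β hαβ c
    obtain ⟨⟨a, b⟩, rfl⟩ := Submodule.mkQ_surjective _ c
    obtain ⟨v, hv⟩ := h β (-α) (by rcases hαβ with h | h <;> simp [h]) (β • a - α • b)
    simp only [LinearMap.add_apply, LinearMap.smul_apply] at hv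
    have key : ∃ w : W, a - x v = α • w ∧ b - y v = β • w := by
      have e : β • (a - x v) = α • (b - y v) := by
        rw [smul_sub, smul_sub]
        rw [neg_smul] at hv
        rw [sub_eq_sub_iff_add_eq_add, ← sub_eq_zero]
        rw [← sub_eq_zero] at hv
        rw [← neg_eq_zero, ← hv]
        abel
      by_cases hα : α = 0
      · have hβ : β ≠ 0 := by rcases hαβ with h | h; exact absurd hα h; exact h
        refine ⟨β⁻¹ • (b - y v), ?_, by rw [smul_inv_smul₀ hβ]⟩
        subst hα
        rw [zero_smul] at e ⊢
        exact (smul_eq_zero.1 e).resolve_left hβ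
      · refine ⟨α⁻¹ • (a - x v), by rw [smul_inv_smul₀ hα], ?_⟩
        rw [smul_comm, e, inv_smul_smul₀ hα]
    obtain ⟨w, hw1, hw2⟩ := key
    refine ⟨w, ?_⟩
    have : (α • i₁ + β • i₂) w = q (a - x v, b - y v) := by
      rw [← hq12, hw1, hw2]; simp
    rw [this]
    refine (Submodule.Quotient.eq _).2 ⟨-v, ?_⟩
    simp [φ]) (by omega) le_rfl
  have hmem : ∀ a b : W, i₁ a + i₂ b = 0 → ∃ v, x v = a ∧ y v = b := by
    intro a b hab
    rw [hq12] at hab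
    obtain ⟨v, hv⟩ := (Submodule.Quotient.mk_eq_zero _).1 hab
    simp only [φ, LinearMap.prod_apply, Function.prod, Prod.mk.injEq] at hv
    exact ⟨v, hv⟩
  have hmem' : ∀ v, i₁ (x v) + i₂ (y v) = 0 := by
    intro v
    rw [hq12]
    exact (Submodule.Quotient.mk_eq_zero _).2 ⟨v, rfl⟩
  have hcompl : IsCompl (W₁.comap x ⊓ W₁.comap y) (W₂.comap x ⊓ W₂.comap y) := by
    constructor
    · rw [Submodule.disjoint_def]
      intro v hv1 hv2
      exact hinj v (Submodule.disjoint_def.1 hW.disjoint _ hv1.1 hv2.1)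
        (Submodule.disjoint_def.1 hW.disjoint _ hv1.2 hv2.2)
    · rw [codisjoint_iff, Submodule.eq_top_iff']
      intro v
      obtain ⟨a1, ha1, a2, ha2, ha⟩ := Submodule.mem_sup.1 (hW.sup_eq_top ▸ Submodule.mem_top : x v ∈ W₁ ⊔ W₂)
      obtain ⟨b1, hb1, b2, hb2, hb⟩ := Submodule.mem_sup.1 (hW.sup_eq_top ▸ Submodule.mem_top : y v ∈ W₁ ⊔ W₂)
      have hz := hmem' v
      rw [← ha, ← hb, map_add, map_add] at hz
      have m1 : i₁ a1 + i₂ b1 ∈ C₁ := C₁.add_mem (h1 _ ha1).1 (h1 _ hb1).2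
      have m2 : i₁ a2 + i₂ b2 ∈ C₂ := C₂.add_mem (h2 _ ha2).1 (h2 _ hb2).2
      have e : i₁ a1 + i₂ b1 = -(i₁ a2 + i₂ b2) := by
        rw [← add_eq_zero_iff_eq_neg, ← hz]; abel
      have z1 : i₁ a1 + i₂ b1 = 0 :=
        Submodule.disjoint_def.1 hC.disjoint _ m1 (e ▸ C₂.neg_mem m2)
      have z2 : i₁ a2 + i₂ b2 = 0 := by rw [z1] at e; exact neg_eq_zero.1 e.symm
      obtain ⟨v1, hx1, hy1⟩ := hmem _ _ z1
      obtain ⟨v2, hx2, hy2⟩ := hmem _ _ z2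
      have hvv : v = v1 + v2 := by
        rw [← sub_eq_zero]
        apply hinj
        · rw [map_sub, map_add, hx1, hx2, ha, sub_self]
        · rw [map_sub, map_add, hy1, hy2, hb, sub_self]
      rw [hvv]
      refine Submodule.add_mem_sup ⟨?_, ?_⟩ ⟨?_, ?_⟩
      · simpa [hx1] using ha1
      · simpa [hy1] using hb1
      · simpa [hx2] using ha2
      · simpa [hy2] using hb2
  have hx : Function.Surjective x := by simpa using h 1 0 (by simp)
  have aux : ∀ U : Submodule k W, U.comap x ⊓ U.comap y = ⊤ → U = ⊤ := by
    intro U hU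
    rw [Submodule.eq_top_iff']
    intro w
    obtain ⟨v, rfl⟩ := hx w
    have : v ∈ U.comap x ⊓ U.comap y := hU ▸ Submodule.mem_top
    exact this.1
  refine ⟨_, _, W₁, W₂, hcompl, hW, fun v hv => ⟨hv.1, hv.2⟩, fun v hv => ⟨hv.1, hv.2⟩, ?_, ?_⟩
  · intro hb
    rw [hb] at hcompl
    have := aux _ (eq_top_of_bot_isCompl hcompl)
    rw [this] at hW
    exact hn1 (eq_bot_of_isCompl_top hW)
  · intro hb
    rw [hb] at hcompl
    have := aux _ (eq_top_of_isCompl_bot hcompl)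
    rw [this] at hW
    exact hn2 (eq_bot_of_top_isCompl hW)

theorem smul_mem_of_xy {N : Type} [AddCommGroup N] [Module (Amod k p) N]
    [Module k N] [IsScalarTower k (Amod k p) N] (S : Submodule k N)
    (hx : ∀ n ∈ S, xA k p • n ∈ S) (hy : ∀ n ∈ S, yA k p • n ∈ S) (a : Amod k p) :
    ∀ n ∈ S, a • n ∈ S := by
  obtain ⟨f, rfl⟩ := Ideal.Quotient.mk_surjective a
  induction f using MvPolynomial.induction_on with
  | C c =>
    intro n hn
    have h1 : (Ideal.Quotient.mk (relI k p) (C c)) = algebraMap k (Amod k p) c := rfl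
    have : (Ideal.Quotient.mk (relI k p) (C c)) • n = c • n := by
      rw [h1, algebraMap_smul]
    rw [this]
    exact S.smul_mem c hn
  | add f g hf hg =>
    intro n hn
    rw [map_add, add_smul]
    exact S.add_mem (hf n hn) (hg n hn)
  | mul_X f i hf =>
    intro n hn
    rw [map_mul, mul_smul]
    apply hf
    fin_cases i
    · exact hx n hn
    · exact hy n hn

/-- The `A`-submodule attached to a `k`-subspace stable under `x` and `y`. -/
def mkSub {N : Type} [AddCommGroup N] [Module (Amod k p) N]
    [Module k N] [IsScalarTower k (Amod k p) N] (S : Submodule k N)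
    (hx : ∀ n ∈ S, xA k p • n ∈ S) (hy : ∀ n ∈ S, yA k p • n ∈ S) :
    Submodule (Amod k p) N where
  carrier := S
  add_mem' := S.add_mem
  zero_mem' := S.zero_mem
  smul_mem' a n hn := smul_mem_of_xy k p S hx hy a n hn

theorem xA_mem : xA k p ∈ mA k p := Ideal.subset_span (by simp)

theorem yA_mem : yA k p ∈ mA k p := Ideal.subset_span (by simp)

theorem EIP_of_surjective {M N : Type} [AddCommGroup M] [Module (Amod k p) M]
    [AddCommGroup N] [Module (Amod k p) N] (f : M →ₗ[Amod k p] N)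
    (hf : Function.Surjective f) (h : EIP k p M) : EIP k p N := by
  intro u hu
  have h1 : mA k p • (⊤ : Submodule (Amod k p) N) =
      (mA k p • (⊤ : Submodule (Amod k p) M)).map f := by
    rw [Submodule.map_smul'', Submodule.map_top, LinearMap.range_eq_top.2 hf]
  rw [h1, ← h u hu]
  ext n
  simp only [LinearMap.mem_range, Submodule.mem_map, LinearMap.lsmul_apply]
  constructor
  · rintro ⟨n, rfl⟩
    obtain ⟨m, rfl⟩ := hf n
    exact ⟨_, ⟨m, rfl⟩, map_smul f u m⟩
  · rintro ⟨_, ⟨m, rfl⟩, rfl⟩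
    exact ⟨f m, (map_smul f u m).symm⟩

theorem exists_kron {N : Type} [AddCommGroup N] [Module (Amod k p) N]
    [Module k N] [IsScalarTower k (Amod k p) N]
    (hE : EIP k p N) (h2 : (mA k p) ^ 2 • (⊤ : Submodule (Amod k p) N) = ⊥) :
    ∃ (V : Submodule k N)
      (x y : V →ₗ[k] (mA k p • (⊤ : Submodule (Amod k p) N)).restrictScalars k),
      IsCompl V ((mA k p • (⊤ : Submodule (Amod k p) N)).restrictScalars k) ∧
      (∀ v, (x v : N) = xA k p • (v : N)) ∧ (∀ v, (y v : N) = yA k p • (v : N)) ∧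
      ∀ α β : k, (α ≠ 0 ∨ β ≠ 0) → Function.Surjective (α • x + β • y) := by
  obtain ⟨V, hV⟩ := Submodule.exists_isCompl
    ((mA k p • (⊤ : Submodule (Amod k p) N)).restrictScalars k)
  let mk (a : Amod k p) (ha : a ∈ mA k p) :
      V →ₗ[k] (mA k p • (⊤ : Submodule (Amod k p) N)).restrictScalars k :=
    LinearMap.codRestrict _ ((LinearMap.restrictScalars k (LinearMap.lsmul (Amod k p) N a)).comp
      V.subtype) (by
        intro v
        have h0 : a • (v : N) ∈ mA k p • (⊤ : Submodule (Amod k p) N) :=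
          Submodule.smul_mem_smul ha Submodule.mem_top
        rw [Submodule.restrictScalars_mem]
        exact h0)
  refine ⟨V, mk _ (xA_mem k p), mk _ (yA_mem k p), hV.symm, fun v => rfl, fun v => rfl, ?_⟩
  rintro α β hαβ ⟨w, hw⟩
  have hw' : w ∈ mA k p • (⊤ : Submodule (Amod k p) N) := hw
  rw [← hE _ ⟨α, β, hαβ, rfl⟩] at hw'
  obtain ⟨n, hn⟩ := hw'
  obtain ⟨w1, hw1, v, hv, rfl⟩ := Submodule.mem_sup.1
    (hV.sup_eq_top ▸ Submodule.mem_top : n ∈ _ ⊔ V)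
  have hz : ∀ a ∈ mA k p, a • w1 = 0 := by
    intro a ha
    have : a • w1 ∈ (mA k p) ^ 2 • (⊤ : Submodule (Amod k p) N) := by
      rw [pow_two, Submodule.mul_smul]
      exact Submodule.smul_mem_smul ha hw1
    rw [h2] at this
    simpa using this
  refine ⟨⟨v, hv⟩, Subtype.ext ?_⟩
  change α • (xA k p • v) + β • (yA k p • v) = w
  rw [← hn]
  simp only [LinearMap.lsmul_apply, smul_add, add_smul, smul_assoc, hz _ (xA_mem k p),
    hz _ (yA_mem k p), smul_zero, zero_add]

theorem dim_bound [IsAlgClosed k] {N : Type} [AddCommGroup N] [Module (Amod k p) N]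
    [Module k N] [IsScalarTower k (Amod k p) N] [FiniteDimensional k N]
    (hE : EIP k p N) (h2 : (mA k p) ^ 2 • (⊤ : Submodule (Amod k p) N) = ⊥)
    (hN : Nontrivial N) :
    2 * finrank k (↥(mA k p • (⊤ : Submodule (Amod k p) N))) + 1 ≤ finrank k N := by
  obtain ⟨V, x, y, hc, hx, hy, hs⟩ := exists_kron k p hE h2
  have hVn : Nontrivial V := by
    rw [Submodule.nontrivial_iff_ne_bot]
    rintro rfl
    have h3 : mA k p • (⊤ : Submodule (Amod k p) N) = ⊤ :=
      (Submodule.restrictScalars_eq_top_iff k _ _).1 (eq_top_of_bot_isCompl hc)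
    rw [pow_two, Submodule.mul_smul, h3, h3] at h2
    exact top_ne_bot h2
  have h4 := kron_dim x y hs hVn
  have h5 := Submodule.finrank_add_eq_of_isCompl hc
  change finrank k (↥(mA k p • (⊤ : Submodule (Amod k p) N))) + 1 ≤ _ at h4
  change _ + finrank k (↥(mA k p • (⊤ : Submodule (Amod k p) N))) = _ at h5
  omega

theorem decomp {N : Type} [AddCommGroup N] [Module (Amod k p) N]
    [Module k N] [IsScalarTower k (Amod k p) N] [FiniteDimensional k N]
    (hE : EIP k p N) (h2 : (mA k p) ^ 2 • (⊤ : Submodule (Amod k p) N) = ⊥)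
    (hN : 2 * finrank k (↥(mA k p • (⊤ : Submodule (Amod k p) N))) + 2 ≤ finrank k N) :
    ∃ N₁ N₂ : Submodule (Amod k p) N, IsCompl N₁ N₂ ∧ N₁ ≠ ⊥ ∧ N₂ ≠ ⊥ := by
  obtain ⟨V, x, y, hc, hx, hy, hs⟩ := exists_kron k p hE h2
  have h5 := Submodule.finrank_add_eq_of_isCompl hc
  have h6 : finrank k (↥(mA k p • (⊤ : Submodule (Amod k p) N))) =
    finrank k ((mA k p • (⊤ : Submodule (Amod k p) N)).restrictScalars k) := rfl
  obtain ⟨V₁, V₂, W₁, W₂, hV, hW, h1', h2', hn1, hn2⟩ :=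
    kron_decomp _ _ _ x y hs (by omega) le_rfl
  have hz : ∀ a ∈ mA k p, ∀ w : (mA k p • (⊤ : Submodule (Amod k p) N)).restrictScalars k,
      a • (w : N) = 0 := by
    intro a ha w
    have : a • (w : N) ∈ (mA k p) ^ 2 • (⊤ : Submodule (Amod k p) N) := by
      rw [pow_two, Submodule.mul_smul]
      exact Submodule.smul_mem_smul ha w.2
    rw [h2] at this
    simpa using this
  let S (V' : Submodule k V) (W' : Submodule k
      ((mA k p • (⊤ : Submodule (Amod k p) N)).restrictScalars k)) : Submodule k N :=
    V'.map V.subtype ⊔ W'.map (Submodule.subtype _)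
  have memS : ∀ V' W' n, n ∈ S V' W' ↔ ∃ v ∈ V', ∃ w ∈ W', (v : N) + (w : N) = n := by
    intro V' W' n
    simp only [S, Submodule.mem_sup, Submodule.mem_map]
    constructor
    · rintro ⟨_, ⟨v, hv, rfl⟩, _, ⟨w, hw, rfl⟩, rfl⟩
      exact ⟨v, hv, w, hw, rfl⟩
    · rintro ⟨v, hv, w, hw, rfl⟩
      exact ⟨_, ⟨v, hv, rfl⟩, _, ⟨w, hw, rfl⟩, rfl⟩
  have stx : ∀ V' W', (∀ v ∈ V', x v ∈ W' ∧ y v ∈ W') → ∀ n ∈ S V' W', xA k p • n ∈ S V' W' := by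
    intro V' W' h n hn
    obtain ⟨v, hv, w, hw, rfl⟩ := (memS _ _ _).1 hn
    refine (memS _ _ _).2 ⟨0, V'.zero_mem, x v, (h v hv).1, ?_⟩
    rw [smul_add, hz _ (xA_mem k p), hx]
    simp
  have sty : ∀ V' W', (∀ v ∈ V', x v ∈ W' ∧ y v ∈ W') → ∀ n ∈ S V' W', yA k p • n ∈ S V' W' := by
    intro V' W' h n hn
    obtain ⟨v, hv, w, hw, rfl⟩ := (memS _ _ _).1 hn
    refine (memS _ _ _).2 ⟨0, V'.zero_mem, y v, (h v hv).2, ?_⟩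
    rw [smul_add, hz _ (yA_mem k p), hy]
    simp
  have nb : ∀ V' W' hx hy, V' ≠ ⊥ → mkSub k p (S V' W') hx hy ≠ ⊥ := by
    intro V' W' hx hy hV' hb
    apply hV'
    rw [Submodule.eq_bot_iff]
    intro v hv
    have : (v : N) ∈ mkSub k p (S V' W') hx hy :=
      (memS _ _ _).2 ⟨v, hv, 0, W'.zero_mem, by simp⟩
    rw [hb] at this
    simpa using this
  refine ⟨mkSub k p (S V₁ W₁) (stx _ _ h1') (sty _ _ h1'),
    mkSub k p (S V₂ W₂) (stx _ _ h2') (sty _ _ h2'), ?_, nb _ _ _ _ hn1, nb _ _ _ _ hn2⟩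
  constructor
  · rw [Submodule.disjoint_def]
    intro n hn1 hn2
    obtain ⟨v1, hv1, w1, hw1, rfl⟩ := (memS _ _ _).1 hn1
    obtain ⟨v2, hv2, w2, hw2, he⟩ := (memS _ _ _).1 hn2
    have e1 : ((v2 - v1 : V) : N) = ((w1 - w2 : (mA k p • (⊤ : Submodule (Amod k p) N)).restrictScalars k) : N) := by
      rw [AddSubgroupClass.coe_sub, AddSubgroupClass.coe_sub, sub_eq_sub_iff_add_eq_add, he,
        add_comm]
    have e2 : ((v2 - v1 : V) : N) = 0 :=
      Submodule.disjoint_def.1 hc.disjoint _ (v2 - v1).2 (e1 ▸ (w1 - w2).2)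
    have e3 : ((w1 - w2 : (mA k p • (⊤ : Submodule (Amod k p) N)).restrictScalars k) : N) = 0 := by
      rw [← e1, e2]
    have e4 : v2 = v1 := sub_eq_zero.1 (Subtype.ext e2)
    have e5 : w1 = w2 := sub_eq_zero.1 (Subtype.ext e3)
    subst e4 e5
    rw [Submodule.disjoint_def.1 hV.disjoint _ hv1 hv2,
      Submodule.disjoint_def.1 hW.disjoint _ hw1 hw2]
    simp
  · rw [codisjoint_iff, Submodule.eq_top_iff']
    intro n
    obtain ⟨v, hv, w, hw, rfl⟩ := Submodule.mem_sup.1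
      (hc.sup_eq_top ▸ Submodule.mem_top : n ∈ V ⊔ _)
    obtain ⟨v1, hv1, v2, hv2, hvv⟩ := Submodule.mem_sup.1
      (hV.sup_eq_top ▸ Submodule.mem_top : (⟨v, hv⟩ : V) ∈ V₁ ⊔ V₂)
    obtain ⟨w1, hw1, w2, hw2, hww⟩ := Submodule.mem_sup.1
      (hW.sup_eq_top ▸ Submodule.mem_top :
        (⟨w, hw⟩ : (mA k p • (⊤ : Submodule (Amod k p) N)).restrictScalars k) ∈ W₁ ⊔ W₂)
    have ev : (v1 : N) + v2 = v := congrArg Subtype.val hvv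
    have ew : (w1 : N) + w2 = w := congrArg Subtype.val hww
    refine Submodule.mem_sup.2 ⟨v1 + w1, (memS _ _ _).2 ⟨v1, hv1, w1, hw1, rfl⟩,
      v2 + w2, (memS _ _ _).2 ⟨v2, hv2, w2, hw2, rfl⟩, ?_⟩
    rw [← ev, ← ew]
    abel

theorem indec_iff [IsAlgClosed k] {N : Type} [AddCommGroup N] [Module (Amod k p) N]
    [Module k N] [IsScalarTower k (Amod k p) N] [FiniteDimensional k N]
    (hE : EIP k p N) (h2 : (mA k p) ^ 2 • (⊤ : Submodule (Amod k p) N) = ⊥) :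
    IsIndecomposableMod k p N ↔
      finrank k N = 2 * finrank k (↥(mA k p • (⊤ : Submodule (Amod k p) N))) + 1 := by
  constructor
  · rintro ⟨hN, hI⟩
    have h3 := dim_bound k p hE h2 hN
    by_contra hne
    obtain ⟨N₁, N₂, hc, h4, h5⟩ := decomp k p hE h2 (by omega)
    rcases hI _ _ hc with h | h
    · exact h4 h
    · exact h5 h
  · intro hd
    refine ⟨Module.nontrivial_of_finrank_pos (R := k) (by omega), ?_⟩
    intro N₁ N₂ hc
    by_contra! hne
    have key : ∀ P Q : Submodule (Amod k p) N, IsCompl P Q → P ≠ ⊥ →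
        2 * finrank k ((mA k p • P).restrictScalars k) + 1 ≤ finrank k (P.restrictScalars k) := by
      intro P Q hPQ hP
      have : FiniteDimensional k P := inferInstanceAs (FiniteDimensional k (P.restrictScalars k))
      have hE' : EIP k p P := EIP_of_surjective k p (Submodule.projectionOnto P Q hPQ)
        (Submodule.projectionOnto_surjective hPQ) hE
      have hmap : ∀ I : Ideal (Amod k p),
          (I • (⊤ : Submodule (Amod k p) P)).map P.subtype = I • P := by
        intro I
        rw [Submodule.map_smul'', Submodule.map_top, Submodule.range_subtype]
      have h2' : (mA k p) ^ 2 • (⊤ : Submodule (Amod k p) P) = ⊥ := by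
        apply Submodule.map_injective_of_injective P.injective_subtype
        rw [hmap, Submodule.map_bot, eq_bot_iff, ← h2]
        exact Submodule.smul_mono le_rfl le_top
      have hb := dim_bound k p hE' h2' ((Submodule.nontrivial_iff_ne_bot).2 hP)
      have hle : finrank k ((mA k p • P).restrictScalars k) ≤
          finrank k ((mA k p • (⊤ : Submodule (Amod k p) P)).restrictScalars k) := by
        have : (mA k p • P).restrictScalars k =
            ((mA k p • (⊤ : Submodule (Amod k p) P)).restrictScalars k).map
              (P.subtype.restrictScalars k) := by
          rw [← hmap]; rfl
        rw [this]
        exact Submodule.finrank_map_le _ _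
      change 2 * finrank k ((mA k p • (⊤ : Submodule (Amod k p) P)).restrictScalars k) + 1
        ≤ finrank k (P.restrictScalars k) at hb
      omega
    have k1 := key _ _ hc hne.1
    have k2 := key _ _ hc.symm hne.2
    have hck : IsCompl (N₁.restrictScalars k) (N₂.restrictScalars k) := by
      constructor
      · rw [Submodule.disjoint_def]
        intro n h1 h2
        exact (Submodule.disjoint_def (p := N₁) (p' := N₂)).1 hc.disjoint n h1 h2
      · rw [codisjoint_iff, Submodule.eq_top_iff']
        intro n
        obtain ⟨a, ha, b, hb, rfl⟩ := Submodule.mem_sup.1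
          (hc.sup_eq_top ▸ Submodule.mem_top : n ∈ N₁ ⊔ N₂)
        exact Submodule.mem_sup.2 ⟨a, ha, b, hb, rfl⟩
    have hs := Submodule.finrank_add_eq_of_isCompl hck
    have hm : (mA k p • (⊤ : Submodule (Amod k p) N)).restrictScalars k ≤
        (mA k p • N₁).restrictScalars k ⊔ (mA k p • N₂).restrictScalars k := by
      intro n hn
      have hn' : n ∈ mA k p • (⊤ : Submodule (Amod k p) N) := hn
      rw [← hc.sup_eq_top, Submodule.smul_sup] at hn'
      obtain ⟨a, ha, b, hb, rfl⟩ := Submodule.mem_sup.1 hn'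
      exact Submodule.mem_sup.2 ⟨a, ha, b, hb, rfl⟩
    have hm' := (Submodule.finrank_mono hm).trans (Submodule.finrank_add_le_finrank_add_finrank _ _)
    change finrank k (↥(mA k p • (⊤ : Submodule (Amod k p) N))) ≤ _ at hm'
    omega

/-- for an equal images module `M`, the quotient `M/𝔪²M` is indecomposable
if and only if `a_1(M) = dim_k M − 2·dim_k 𝔪M + dim_k 𝔪²M` equals `1`. -/
theorem quot_sq_indecomposable_iff_a1_eq_one
    [IsAlgClosed k] [Fact p.Prime] [CharP k p]
    (M : Type) [AddCommGroup M] [Module (Amod k p) M]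
    [Module k M] [IsScalarTower k (Amod k p) M] [FiniteDimensional k M]
    (hE : EIP k p M) :
    IsIndecomposableMod k p (M ⧸ ((mA k p) ^ 2 • (⊤ : Submodule (Amod k p) M))) ↔
      (finrank k M : ℤ)
        - 2 * finrank k (↥(mA k p • (⊤ : Submodule (Amod k p) M)))
        + finrank k (↥((mA k p) ^ 2 • (⊤ : Submodule (Amod k p) M))) = 1 := by
  set Q := (mA k p) ^ 2 • (⊤ : Submodule (Amod k p) M) with hQ
  have hE' : EIP k p (M ⧸ Q) := EIP_of_surjective k p Q.mkQ (Submodule.mkQ_surjective Q) hE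
  have hmap : ∀ I : Ideal (Amod k p), I • (⊤ : Submodule (Amod k p) (M ⧸ Q)) =
      (I • (⊤ : Submodule (Amod k p) M)).map Q.mkQ := by
    intro I
    rw [Submodule.map_smul'', Submodule.map_top, Submodule.range_mkQ]
  have h2 : (mA k p) ^ 2 • (⊤ : Submodule (Amod k p) (M ⧸ Q)) = ⊥ := by
    rw [hmap, ← hQ, Submodule.mkQ_map_self]
  have : FiniteDimensional k (M ⧸ Q) :=
    Module.Finite.of_surjective (Q.mkQ.restrictScalars k) (Submodule.mkQ_surjective Q)
  rw [indec_iff k p hE' h2]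
  have hQle : Q ≤ mA k p • (⊤ : Submodule (Amod k p) M) := by
    rw [hQ, pow_two, Submodule.mul_smul]
    exact Submodule.smul_mono le_rfl le_top
  have d1 : finrank k (M ⧸ Q) + finrank k Q = finrank k M := by
    have h := LinearMap.finrank_range_add_finrank_ker (Q.mkQ.restrictScalars k)
    have e1 : LinearMap.range (Q.mkQ.restrictScalars k) = ⊤ :=
      LinearMap.range_eq_top.2 (Submodule.mkQ_surjective Q)
    have e2 : LinearMap.ker (Q.mkQ.restrictScalars k) = Q.restrictScalars k := by
      ext m
      simp
    rw [e1, e2, finrank_top] at h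
    exact h
  have d2 : finrank k (↥(mA k p • (⊤ : Submodule (Amod k p) (M ⧸ Q)))) + finrank k Q =
      finrank k (↥(mA k p • (⊤ : Submodule (Amod k p) M))) := by
    let S := (mA k p • (⊤ : Submodule (Amod k p) M)).restrictScalars k
    have h := LinearMap.finrank_range_add_finrank_ker ((Q.mkQ.restrictScalars k).domRestrict S)
    have e1 : LinearMap.range ((Q.mkQ.restrictScalars k).domRestrict S) =
        (mA k p • (⊤ : Submodule (Amod k p) (M ⧸ Q))).restrictScalars k := by
      rw [hmap, LinearMap.range_domRestrict]
      rfl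
    have e2 : LinearMap.ker ((Q.mkQ.restrictScalars k).domRestrict S) =
        (Q.restrictScalars k).comap S.subtype := by
      ext m
      simp
    have e3 : finrank k ((Q.restrictScalars k).comap S.subtype) =
        finrank k (Q.restrictScalars k) :=
      (Submodule.comapSubtypeEquivOfLe (p := Q.restrictScalars k) (q := S) hQle).finrank_eq
    rw [e1, e2, e3] at h
    exact h
  omega

end
end
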